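/- For every nonempty s-uniform hypergraph H, every p_0 < 1, and every ε > 0, there exists a constant L such that the following holds: if L·n^{−1/m_s(H)} ≤ p ≤ p_0 and X denotes the number N_H(G^{(s)}(n,p)) of copies of H in the binomial random s-uniform hypergraph G^{(s)}(n,p), then for every η ∈ [0,1], (1−ε)·Φ_{n,p}^H(η+ε) ≤ −log Pr(X ≤ η·E[X]) ≤ (1+ε)·Φ_{n,p}^H((1−ε)η). -/

import Mathlib

open Classical

noncomputable section

/-- The edges of the complete `s`-uniform hypergraph on `{1,…,n}`: `s`-element subsets. -/
abbrev SEdge (n s : ℕ) := {e : Finset (Fin n) // e.card = s}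

/-- The probability of the hypergraph (configuration) `ω` under the product measure in
which each `s`-set `e` is retained independently with probability `q e`: this is
`G^{(s)}(n, q)`. -/
def pw {V : Type*} [Fintype V] [DecidableEq V] (q : V → ℝ) (ω : Finset V) : ℝ :=
  (∏ e ∈ ω, q e) * ∏ e ∈ ωᶜ, (1 - q e)

/-- The relative entropy `i_p(q) = D_KL(Ber(q) ‖ Ber(p))`.  (In Lean `Real.log 0 = 0`,
which implements the convention `0 · log 0 = 0`.) -/
def ip (p q : ℝ) : ℝ :=
  q * Real.log (q / p) + (1 - q) * Real.log ((1 - q) / (1 - p))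

/-- The number of copies (embeddings) of the `s`-uniform hypergraph `𝓗` (on vertex set
`β`) in the `s`-uniform hypergraph `ω ⊆ E(K_n^{(s)})`. -/
def copyCountH {β : Type*} [Fintype β] [DecidableEq β] (𝓗 : Finset (Finset β))
    (n s : ℕ) (ω : Finset (SEdge n s)) : ℕ :=
  (Finset.univ.filter fun φ : β ↪ Fin n =>
    ∀ A ∈ 𝓗, ∀ h : (A.map φ).card = s, (⟨A.map φ, h⟩ : SEdge n s) ∈ ω).card

/-- `E[N_H(G^{(s)}(n, q))]`: the expected number of copies of `𝓗` in `G^{(s)}(n, q)`. -/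
def expCopyH {β : Type*} [Fintype β] [DecidableEq β] (𝓗 : Finset (Finset β))
    (n s : ℕ) (q : SEdge n s → ℝ) : ℝ :=
  ∑ ω : Finset (SEdge n s), pw q ω * (copyCountH 𝓗 n s ω : ℝ)

/-- `Φ_{n,p}^H(η) = min { ∑_e i_p(q_e) : E[N_H(G^{(s)}(n,q))] ≤ η E[N_H(G^{(s)}(n,p))] }`. -/
def PhiCopyH {β : Type*} [Fintype β] [DecidableEq β] (𝓗 : Finset (Finset β))
    (n s : ℕ) (p η : ℝ) : ℝ :=
  sInf {x | ∃ q : SEdge n s → ℝ, (∀ e, q e ∈ Set.Icc (0 : ℝ) 1) ∧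
    expCopyH 𝓗 n s q ≤ η * expCopyH 𝓗 n s (fun _ => p) ∧ x = ∑ e, ip p (q e)}

/-- `Pr(X ≤ η E[X])` where `X = N_H(G^{(s)}(n,p))`. -/
def PrCopyH {β : Type*} [Fintype β] [DecidableEq β] (𝓗 : Finset (Finset β))
    (n s : ℕ) (p η : ℝ) : ℝ :=
  ∑ ω : Finset (SEdge n s),
    if (copyCountH 𝓗 n s ω : ℝ) ≤ η * expCopyH 𝓗 n s (fun _ => p)
    then pw (fun _ => p) ω else 0

/-- The `s`-density `m_s(H)` of an `s`-uniform hypergraph `𝓗`: if `𝓗` has at least two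
edges it is `max {(e_F − 1)/(v_F − s) : F ⊆ H, e_F ≥ 2}` (the maximum over nonempty edge
subsets `𝓕`, with `v_F` the number of covered vertices); otherwise it is `1/s`. -/
def msDensity {β : Type*} [DecidableEq β] (𝓗 : Finset (Finset β)) (s : ℕ) : ℝ :=
  if 2 ≤ 𝓗.card then
    sSup {x | ∃ 𝓕 : Finset (Finset β), 𝓕 ⊆ 𝓗 ∧ 2 ≤ 𝓕.card ∧
      x = ((𝓕.card : ℝ) - 1) / (((𝓕.biUnion id).card : ℝ) - s)}
  else 1 / (s : ℝ)

section ProductMeasure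

variable {V : Type*} [Fintype V] [DecidableEq V]

lemma pw_nonneg {q : V → ℝ} (hq : ∀ e, q e ∈ Set.Icc (0 : ℝ) 1) (ω : Finset V) : 0 ≤ pw q ω :=
  mul_nonneg (Finset.prod_nonneg fun e _ => (hq e).1)
    (Finset.prod_nonneg fun e _ => sub_nonneg.2 (hq e).2)

/-- The product measure of `{ω : B ⊆ ω}` is `∏ e ∈ B, q e`. -/
lemma sum_pw_superset (q : V → ℝ) (B : Finset V) :
    ∑ ω : Finset V, pw q ω * (if B ⊆ ω then 1 else 0) = ∏ e ∈ B, q e := by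
  have h := Fintype.prod_add q (fun e => if e ∈ B then 0 else 1 - q e)
  have h1 : ∏ e, (q e + if e ∈ B then 0 else 1 - q e) = ∏ e ∈ B, q e := by
    rw [← Finset.prod_subset (Finset.subset_univ B)]
    · exact Finset.prod_congr rfl fun e he => by simp [he]
    · intro e _ he; simp [he]
  rw [← h1, h]
  refine Finset.sum_congr rfl fun ω _ => ?_
  unfold pw
  by_cases hB : B ⊆ ω
  · rw [if_pos hB, mul_one]
    congr 1
    refine Finset.prod_congr rfl fun e he => ?_
    rw [if_neg fun heB => (Finset.mem_compl.1 he) (hB heB)]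
  · rw [if_neg hB, mul_zero]
    obtain ⟨e, he, heω⟩ := Finset.not_subset.1 hB
    rw [Finset.prod_eq_zero (i := e) (s := ωᶜ) (Finset.mem_compl.2 heω) (by simp [he]), mul_zero]

lemma sum_pw (q : V → ℝ) : ∑ ω : Finset V, pw q ω = 1 := by
  simpa using sum_pw_superset q ∅

lemma sum_pw_mem (q : V → ℝ) (v : V) :
    ∑ ω : Finset V, pw q ω * (if v ∈ ω then 1 else 0) = q v := by
  simpa using sum_pw_superset q {v}

lemma sum_pw_mem_mem (q : V → ℝ) {u v : V} (h : u ≠ v) :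
    ∑ ω : Finset V, pw q ω * ((if u ∈ ω then 1 else 0) * (if v ∈ ω then 1 else 0)) =
      q u * q v := by
  have := sum_pw_superset q {u, v}
  rw [Finset.prod_pair h] at this
  rw [← this]
  refine Finset.sum_congr rfl fun ω _ => ?_
  by_cases hu : u ∈ ω <;> by_cases hv : v ∈ ω <;> simp [hu, hv, Finset.insert_subset_iff]

/-- The product measure of `{ω : B ⊆ ω, v ∉ ω}`. -/
lemma sum_pw_superset_notMem (q : V → ℝ) {B : Finset V} {v : V} (hv : v ∉ B) :
    ∑ ω : Finset V, pw q ω * ((if B ⊆ ω then 1 else 0) * (if v ∈ ω then 0 else 1)) =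
      (∏ e ∈ B, q e) * (1 - q v) := by
  have h1 := sum_pw_superset q B
  have h2 := sum_pw_superset q (insert v B)
  rw [Finset.prod_insert hv] at h2
  have : (∏ e ∈ B, q e) * (1 - q v) = (∏ e ∈ B, q e) - q v * ∏ e ∈ B, q e := by ring
  rw [this, ← h2, ← h1, ← Finset.sum_sub_distrib]
  refine Finset.sum_congr rfl fun ω _ => ?_
  by_cases hB : B ⊆ ω <;> by_cases hvω : v ∈ ω <;> simp [hB, hvω, Finset.insert_subset_iff]

/-- The product measure of the cylinder `{ω : ω ∩ R = y ∩ R}`. -/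
lemma sum_pw_cylinder (q : V → ℝ) (R y : Finset V) :
    ∑ ω : Finset V, (if ω ∩ R = y ∩ R then pw q ω else 0) =
      ∏ v ∈ R, (if v ∈ y then q v else 1 - q v) := by
  have h := Fintype.prod_add (fun e => if e ∈ R ∧ e ∉ y then 0 else q e)
    (fun e => if e ∈ R ∧ e ∈ y then 0 else 1 - q e)
  have h1 : ∏ e, ((if e ∈ R ∧ e ∉ y then 0 else q e) + if e ∈ R ∧ e ∈ y then 0 else 1 - q e)
      = ∏ v ∈ R, (if v ∈ y then q v else 1 - q v) := by
    rw [← Finset.prod_subset (Finset.subset_univ R)]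
    · refine Finset.prod_congr rfl fun e he => ?_
      by_cases hy : e ∈ y <;> simp [he, hy]
    · intro e _ he; simp [he]
  rw [← h1, h]
  refine Finset.sum_congr rfl fun ω _ => ?_
  unfold pw
  by_cases hω : ω ∩ R = y ∩ R
  · have hiff : ∀ e ∈ R, (e ∈ ω ↔ e ∈ y) := fun e he => by
      have := congrArg (e ∈ ·) hω
      simpa [he] using this
    rw [if_pos hω]
    congr 1
    · refine Finset.prod_congr rfl fun e he => ?_
      rw [if_neg]
      rintro ⟨h1, h2⟩
      exact h2 ((hiff e h1).1 he)
    · refine Finset.prod_congr rfl fun e he => ?_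
      rw [if_neg]
      rintro ⟨h1, h2⟩
      exact (Finset.mem_compl.1 he) ((hiff e h1).2 h2)
  · rw [if_neg hω]
    have : ∃ e ∈ R, ¬ (e ∈ ω ↔ e ∈ y) := by
      by_contra! hcon
      refine hω (Finset.ext fun e => ?_)
      by_cases he : e ∈ R
      · simp [he, hcon e he]
      · simp [he]
    obtain ⟨e, heR, he⟩ := this
    by_cases heω : e ∈ ω
    · rw [Finset.prod_eq_zero (i := e) (s := ω) heω (by
        rw [if_pos ⟨heR, fun hy => he ⟨fun _ => hy, fun _ => heω⟩⟩]), zero_mul]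
    · rw [Finset.prod_eq_zero (i := e) (s := ωᶜ) (Finset.mem_compl.2 heω) (by
        rw [if_pos]
        exact ⟨heR, by by_contra hy; exact he ⟨fun h => (heω h).elim, fun h => (hy h).elim⟩⟩),
        mul_zero]

lemma pw_insert {q : V → ℝ} {ω : Finset V} {v : V} (hv : v ∉ ω) :
    (1 - q v) * pw q (insert v ω) = q v * pw q ω := by
  unfold pw
  have h1 : ωᶜ = insert v (insert v ω)ᶜ := by
    ext e; by_cases h : e = v <;> simp [h, hv]
  rw [Finset.prod_insert hv, h1, Finset.prod_insert (by simp)]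
  ring

lemma pw_pos {q : V → ℝ} (hq : ∀ e, q e ∈ Set.Ioo (0 : ℝ) 1) (ω : Finset V) : 0 < pw q ω :=
  mul_pos (Finset.prod_pos fun e _ => (hq e).1) (Finset.prod_pos fun e _ => sub_pos.2 (hq e).2)

lemma pw_eq_prod (q : V → ℝ) (ω : Finset V) :
    pw q ω = ∏ v, (if v ∈ ω then q v else 1 - q v) := by
  unfold pw
  rw [← Finset.prod_mul_prod_compl ω]
  congr 1
  · exact Finset.prod_congr rfl fun e he => by rw [if_pos he]
  · exact Finset.prod_congr rfl fun e he => by rw [if_neg (Finset.mem_compl.1 he)]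

end ProductMeasure

section Conditioning

variable {V : Type*} [Fintype V] [DecidableEq V]

/-- The conditional probability of `v ∈ ω'` given `ω' ∩ W = ω ∩ W`, for the (unnormalised)
measure with weights `m`. -/
def condProb (m : Finset V → ℝ) (W : Finset V) (v : V) (ω : Finset V) : ℝ :=
  (∑ ω' : Finset V, if ω' ∩ W = ω ∩ W then m ω' * (if v ∈ ω' then 1 else 0) else 0) /
    ∑ ω' : Finset V, if ω' ∩ W = ω ∩ W then m ω' else 0

lemma condProb_congr (m : Finset V → ℝ) (W : Finset V) (v : V) {ω ω' : Finset V}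
    (h : ω ∩ W = ω' ∩ W) : condProb m W v ω = condProb m W v ω' := by
  unfold condProb; rw [h]

lemma condProb_nonneg {m : Finset V → ℝ} (hm : ∀ ω, 0 ≤ m ω) (W : Finset V) (v : V)
    (ω : Finset V) : 0 ≤ condProb m W v ω := by
  refine div_nonneg (Finset.sum_nonneg fun ω' _ => ?_) (Finset.sum_nonneg fun ω' _ => ?_)
  · split_ifs <;> simp [hm]
  · split_ifs <;> simp [hm]

/-- The tower property: functions depending only on `ω ∩ W` cannot distinguish the indicator
of `v ∈ ω` from its conditional probability. -/
lemma sum_mul_condProb {m : Finset V → ℝ} (hm : ∀ ω, 0 ≤ m ω) (W : Finset V) (v : V)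
    {f : Finset V → ℝ} (hf : ∀ ω ω', ω ∩ W = ω' ∩ W → f ω = f ω') :
    ∑ ω, m ω * f ω * condProb m W v ω = ∑ ω, m ω * f ω * (if v ∈ ω then 1 else 0) := by
  set M : Finset V → ℝ := fun ω => ∑ ω' : Finset V, if ω' ∩ W = ω ∩ W then m ω' else 0 with hM
  have hMc : ∀ ω ω', ω ∩ W = ω' ∩ W → M ω = M ω' := fun ω ω' h => by simp only [hM, h]
  calc ∑ ω, m ω * f ω * condProb m W v ω
      = ∑ ω, ∑ ω', (if ω' ∩ W = ω ∩ W then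
          m ω * f ω * (m ω' * (if v ∈ ω' then 1 else 0)) / M ω else 0) := by
        refine Finset.sum_congr rfl fun ω _ => ?_
        unfold condProb
        rw [← mul_div_assoc, Finset.mul_sum, Finset.sum_div]
        refine Finset.sum_congr rfl fun ω' _ => ?_
        by_cases h : ω' ∩ W = ω ∩ W
        · simp only [if_pos h, hM]
        · simp only [if_neg h, mul_zero, zero_div]
    _ = ∑ ω', ∑ ω, (if ω' ∩ W = ω ∩ W then
          m ω * f ω * (m ω' * (if v ∈ ω' then 1 else 0)) / M ω else 0) := Finset.sum_comm
    _ = ∑ ω, m ω * f ω * (if v ∈ ω then 1 else 0) := by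
        refine Finset.sum_congr rfl fun ω' _ => ?_
        have h1 : ∀ ω, (if ω' ∩ W = ω ∩ W then
            m ω * f ω * (m ω' * (if v ∈ ω' then 1 else 0)) / M ω else 0) =
            (f ω' * (m ω' * (if v ∈ ω' then 1 else 0)) / M ω') *
              (if ω ∩ W = ω' ∩ W then m ω else 0) := by
          intro ω
          by_cases h : ω' ∩ W = ω ∩ W
          · rw [if_pos h, if_pos h.symm, hf _ _ h, hMc _ _ h]; ring
          · rw [if_neg h, if_neg (show ¬ ω ∩ W = ω' ∩ W from fun h' => h h'.symm), mul_zero]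
        rw [Finset.sum_congr rfl fun ω _ => h1 ω, ← Finset.mul_sum]
        change _ / M ω' * M ω' = _
        by_cases h0 : M ω' = 0
        · have : m ω' = 0 := by
            have h2 : ∀ ω ∈ (Finset.univ : Finset (Finset V)),
                0 ≤ (if ω ∩ W = ω' ∩ W then m ω else 0) := fun ω _ => by
              split_ifs <;> simp [hm]
            have := (Finset.sum_eq_zero_iff_of_nonneg h2).1 h0 ω' (Finset.mem_univ _)
            simpa using this
          rw [h0, this]; ring
        · rw [div_mul_cancel₀ _ h0]; ring

lemma sum_condProb_mul_condProb {m : Finset V → ℝ} (hm : ∀ ω, 0 ≤ m ω) {W W' : Finset V}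
    (hW : W ⊆ W') (v : V) :
    ∑ ω, m ω * condProb m W v ω * condProb m W' v ω = ∑ ω, m ω * condProb m W v ω ^ 2 := by
  rw [sum_mul_condProb hm W' v (f := condProb m W v), ← sum_mul_condProb hm W v (f := condProb m W v)]
  · exact Finset.sum_congr rfl fun ω _ => by ring
  · exact fun ω ω' h => condProb_congr m W v h
  · intro ω ω' h
    refine condProb_congr m W v ?_
    rw [← Finset.inter_eq_right.2 hW, ← Finset.inter_assoc, ← Finset.inter_assoc, h]

lemma sum_condProb_sub_sq {m : Finset V → ℝ} (hm : ∀ ω, 0 ≤ m ω) {W W' : Finset V}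
    (hW : W ⊆ W') (v : V) :
    ∑ ω, m ω * (condProb m W' v ω - condProb m W v ω) ^ 2 =
      ∑ ω, m ω * condProb m W' v ω ^ 2 - ∑ ω, m ω * condProb m W v ω ^ 2 := by
  have h := sum_condProb_mul_condProb hm hW v
  calc _ = ∑ ω, m ω * condProb m W' v ω ^ 2 + ∑ ω, m ω * condProb m W v ω ^ 2
      - 2 * ∑ ω, m ω * condProb m W v ω * condProb m W' v ω := by
        rw [Finset.mul_sum, ← Finset.sum_add_distrib, ← Finset.sum_sub_distrib]
        exact Finset.sum_congr rfl fun ω _ => by ring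
    _ = _ := by rw [h]; ring

lemma sum_eq_sum_notMem_insert (v : V) (g : Finset V → ℝ) :
    ∑ ω, g ω = ∑ ω ∈ (Finset.univ.erase v).powerset, (g ω + g (insert v ω)) := by
  have h := Finset.sum_powerset_insert (Finset.notMem_erase v (Finset.univ : Finset V)) g
  rw [Finset.insert_erase (Finset.mem_univ v), Finset.powerset_univ] at h
  rw [h, Finset.sum_add_distrib]

/-- For weights `m` whose odds of containing any given `v` are at most those of density `p`,
the weight of `v ∈ ω` is at most a proportion `p`, also after weighting with a function that
does not depend on whether `v ∈ ω`. -/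
lemma sum_mem_le {m : Finset V → ℝ} {p : ℝ}
    (hdown : ∀ (v : V) ω, v ∉ ω → (1 - p) * m (insert v ω) ≤ p * m ω) (v : V)
    {f : Finset V → ℝ} (hf0 : ∀ ω, 0 ≤ f ω) (hf : ∀ ω, v ∉ ω → f (insert v ω) = f ω) :
    ∑ ω, m ω * f ω * (if v ∈ ω then 1 else 0) ≤ p * ∑ ω, m ω * f ω := by
  rw [sum_eq_sum_notMem_insert v, sum_eq_sum_notMem_insert v, Finset.mul_sum]
  refine Finset.sum_le_sum fun ω hω => ?_
  have hv : v ∉ ω := fun h => by simpa using Finset.mem_powerset.1 hω h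
  rw [if_neg hv, if_pos (Finset.mem_insert_self v ω), hf ω hv]
  have := mul_le_mul_of_nonneg_right (hdown v ω hv) (hf0 ω)
  linarith

lemma sum_superset_le {m : Finset V → ℝ} {p : ℝ} (hp : 0 ≤ p)
    (hdown : ∀ (v : V) ω, v ∉ ω → (1 - p) * m (insert v ω) ≤ p * m ω) (B : Finset V) :
    ∑ ω, m ω * (if B ⊆ ω then 1 else 0) ≤ p ^ B.card * ∑ ω, m ω := by
  induction B using Finset.induction_on with
  | empty => simp
  | insert v B hv ih =>
    rw [Finset.card_insert_of_notMem hv, pow_succ', mul_assoc]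
    refine le_trans (le_of_eq_of_le ?_ (sum_mem_le hdown v
      (f := fun ω => if B ⊆ ω then 1 else 0) (fun ω => by split_ifs <;> simp) ?_))
      (mul_le_mul_of_nonneg_left ih hp)
    · refine Finset.sum_congr rfl fun ω _ => ?_
      by_cases h1 : B ⊆ ω <;> by_cases h2 : v ∈ ω <;> simp [h1, h2, Finset.insert_subset_iff]
    · intro ω _
      simp only [Finset.subset_insert_iff_of_notMem hv]

lemma condProb_le {m : Finset V → ℝ} (hm : ∀ ω, 0 ≤ m ω) {p : ℝ} (hp : 0 ≤ p)
    (hdown : ∀ (v : V) ω, v ∉ ω → (1 - p) * m (insert v ω) ≤ p * m ω) {W : Finset V} {v : V}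
    (hv : v ∉ W) (ω : Finset V) : condProb m W v ω ≤ p := by
  unfold condProb
  have h := sum_mem_le hdown v (f := fun ω' => if ω' ∩ W = ω ∩ W then 1 else 0)
    (fun ω => by split_ifs <;> simp) (fun ω' _ => by
      simp only [Finset.insert_inter_of_notMem hv])
  refine div_le_of_le_mul₀ (Finset.sum_nonneg fun ω' _ => by split_ifs <;> simp [hm]) hp ?_
  refine le_of_eq_of_le (Finset.sum_congr rfl fun ω' _ => ?_)
    (h.trans_eq (congrArg _ (Finset.sum_congr rfl fun ω' _ => ?_)))
  · by_cases h : ω' ∩ W = ω ∩ W <;> simp [h]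
  · by_cases h : ω' ∩ W = ω ∩ W <;> simp [h]

/-- The expected squared conditional probabilities, given the configuration on `R`. -/
def energy (m : Finset V → ℝ) (R : Finset V) : ℝ :=
  ∑ v, ∑ ω, m ω * condProb m (R.erase v) v ω ^ 2

lemma energy_nonneg {m : Finset V → ℝ} (hm : ∀ ω, 0 ≤ m ω) (R : Finset V) : 0 ≤ energy m R :=
  Finset.sum_nonneg fun _ _ => Finset.sum_nonneg fun ω _ => mul_nonneg (hm ω) (sq_nonneg _)

lemma energy_le {m : Finset V → ℝ} (hm : ∀ ω, 0 ≤ m ω) {p : ℝ} (hp : 0 ≤ p)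
    (hdown : ∀ (v : V) ω, v ∉ ω → (1 - p) * m (insert v ω) ≤ p * m ω) (R : Finset V) :
    energy m R ≤ Fintype.card V * p ^ 2 * ∑ ω, m ω := by
  have : ∀ v ∈ (Finset.univ : Finset V),
      ∑ ω, m ω * condProb m (R.erase v) v ω ^ 2 ≤ p ^ 2 * ∑ ω, m ω := fun v _ => by
    rw [Finset.mul_sum]
    refine Finset.sum_le_sum fun ω _ => ?_
    rw [mul_comm]
    exact mul_le_mul_of_nonneg_right (pow_le_pow_left₀ (condProb_nonneg hm _ _ _)
      (condProb_le hm hp hdown (Finset.notMem_erase v R) ω) 2) (hm ω)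
  refine (Finset.sum_le_sum this).trans (le_of_eq ?_)
  simp [mul_assoc]

lemma sum_condProb_sub_sq_le_energy {m : Finset V → ℝ} (hm : ∀ ω, 0 ≤ m ω)
    {R R' : Finset V} (hR : R ⊆ R') :
    ∑ v, (if v ∈ R' then 0 else ∑ ω, m ω * (condProb m R' v ω - condProb m R v ω) ^ 2) ≤
      energy m R' - energy m R := by
  unfold energy
  rw [← Finset.sum_sub_distrib]
  refine Finset.sum_le_sum fun v _ => ?_
  rw [← sum_condProb_sub_sq hm (Finset.erase_subset_erase v hR)]
  by_cases hv : v ∈ R'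
  · rw [if_pos hv]
    exact Finset.sum_nonneg fun ω _ => mul_nonneg (hm ω) (sq_nonneg _)
  · rw [if_neg hv, Finset.erase_eq_of_notMem hv, Finset.erase_eq_of_notMem fun h => hv (hR h)]

end Conditioning

section RelativeEntropy

lemma sub_le_mul_log_div {x y : ℝ} (hx : 0 ≤ x) (hy : 0 < y) (τ : ℝ) :
    x - y * Real.exp (-τ) - τ * x ≤ x * Real.log (x / y) := by
  rcases hx.eq_or_lt with rfl | hx
  · have := mul_pos hy (Real.exp_pos (-τ))
    simp only [zero_div, zero_mul, mul_zero]
    linarith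
  · have h := Real.log_le_sub_one_of_pos (div_pos (mul_pos hy (Real.exp_pos (-τ))) hx)
    rw [Real.log_div (mul_pos hy (Real.exp_pos _)).ne' hx.ne',
      Real.log_mul hy.ne' (Real.exp_pos _).ne', Real.log_exp] at h
    rw [Real.log_div hx.ne' hy.ne']
    have h2 := mul_le_mul_of_nonneg_left h hx.le
    have h3 : x * (y * Real.exp (-τ) / x - 1) = y * Real.exp (-τ) - x := by field_simp
    rw [h3] at h2
    linarith

lemma ip_ge {p q : ℝ} (hp : p ∈ Set.Ioo (0 : ℝ) 1) (hq : q ∈ Set.Icc (0 : ℝ) 1) (τ : ℝ) :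
    p * (1 - Real.exp (-τ)) - τ * q ≤ ip p q := by
  have h1 := sub_le_mul_log_div hq.1 hp.1 τ
  have h2 := sub_le_mul_log_div (sub_nonneg.2 hq.2) (sub_pos.2 hp.2) 0
  unfold ip
  simp only [neg_zero, Real.exp_zero] at h2
  linarith

lemma ip_nonneg {p q : ℝ} (hp : p ∈ Set.Ioo (0 : ℝ) 1) (hq : q ∈ Set.Icc (0 : ℝ) 1) :
    0 ≤ ip p q := by
  simpa using ip_ge hp hq 0

lemma ip_self {p : ℝ} (hp : p ∈ Set.Ioo (0 : ℝ) 1) : ip p p = 0 := by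
  unfold ip
  rw [div_self hp.1.ne', div_self (sub_pos.2 hp.2).ne', Real.log_one]; ring

variable {V : Type*} [Fintype V] [DecidableEq V]

lemma sum_pw_condProb (m : Finset V → ℝ) (p : ℝ) (R : Finset V) :
    ∑ ω : Finset V, pw (fun v => if v ∈ R then p else condProb m R v ω) ω = 1 := by
  rw [← sum_pw (fun _ : V => p)]
  have key : ∀ g : Finset V → ℝ, ∑ ω, g ω = ∑ y : Finset V, ∑ ω, if ω ∩ R = y then g ω else 0 := by
    intro g
    rw [Finset.sum_comm]
    exact Finset.sum_congr rfl fun ω _ => by simp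
  rw [key, key (pw fun _ => p)]
  refine Finset.sum_congr rfl fun y _ => ?_
  by_cases hy : y ∩ R = y
  · have h1 := sum_pw_cylinder (fun v => if v ∈ R then p else condProb m R v y) R y
    have h2 := sum_pw_cylinder (fun _ => p) R y
    rw [hy] at h1 h2
    rw [h2]
    refine (Finset.sum_congr rfl fun ω _ => ?_).trans (h1.trans ?_)
    · by_cases h : ω ∩ R = y
      · rw [if_pos h, if_pos h]
        congr 1
        funext v
        rw [condProb_congr m R v (h.trans hy.symm)]
      · rw [if_neg h, if_neg h]
    · exact Finset.prod_congr rfl fun v hv => by simp [hv]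
  · have : ∀ ω, ¬ ω ∩ R = y := by
      rintro ω rfl
      exact hy (by rw [Finset.inter_assoc, Finset.inter_self])
    simp [this]

lemma condProb_pos {m : Finset V → ℝ} (hm : ∀ ω, 0 ≤ m ω) {W ω : Finset V} {v : V}
    (hω : 0 < m ω) (hv : v ∈ ω) : 0 < condProb m W v ω := by
  refine div_pos (Finset.sum_pos' (fun ω' _ => ?_) ⟨ω, Finset.mem_univ _, ?_⟩)
    (Finset.sum_pos' (fun ω' _ => ?_) ⟨ω, Finset.mem_univ _, ?_⟩)
  · split_ifs <;> simp [hm]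
  · simpa [hv] using hω
  · split_ifs <;> simp [hm]
  · simpa using hω

/-- The relative entropy of a conditioned product measure dominates the expected relative
entropies of its conditional marginals given the configuration on `R`. -/
lemma sum_ip_condProb_le {m : Finset V → ℝ} (hm : ∀ ω, 0 ≤ m ω) {p : ℝ}
    (hp : p ∈ Set.Ioo (0 : ℝ) 1)
    (hdown : ∀ (v : V) ω, v ∉ ω → (1 - p) * m (insert v ω) ≤ p * m ω)
    (hmp : ∀ ω, m ω ≠ 0 → m ω = pw (fun _ => p) ω) (hP : 0 < ∑ ω, m ω) (R : Finset V) :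
    ∑ ω, m ω * ∑ v ∈ Rᶜ, ip p (condProb m R v ω) ≤
      (∑ ω, m ω) * (- Real.log (∑ ω, m ω)) := by
  set P := ∑ ω, m ω with hPdef
  have hp1 : 0 < 1 - p := sub_pos.2 hp.2
  have hq0 : ∀ v ω, 0 ≤ condProb m R v ω := fun v ω => condProb_nonneg hm R v ω
  have hqp : ∀ v ∈ Rᶜ, ∀ ω, condProb m R v ω ≤ p := fun v hv ω =>
    condProb_le hm hp.1.le hdown (Finset.mem_compl.1 hv) ω
  set ν : Finset V → ℝ := fun ω => pw (fun v => if v ∈ R then p else condProb m R v ω) ω with hν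
  have hν0 : ∀ ω, 0 ≤ ν ω := fun ω => pw_nonneg (fun v => by
    by_cases hv : v ∈ R
    · simp only [if_pos hv]; exact ⟨hp.1.le, hp.2.le⟩
    · simp only [if_neg hv]
      exact ⟨hq0 v ω, (hqp v (Finset.mem_compl.2 hv) ω).trans hp.2.le⟩) ω
  set t : V → Finset V → ℝ := fun v ω =>
    (if v ∈ ω then 1 else 0) * Real.log (condProb m R v ω / p) +
      (1 - (if v ∈ ω then 1 else 0)) * Real.log ((1 - condProb m R v ω) / (1 - p)) with ht
  have h1 : ∑ ω, m ω * ∑ v ∈ Rᶜ, ip p (condProb m R v ω) = ∑ ω, m ω * ∑ v ∈ Rᶜ, t v ω := by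
    simp only [Finset.mul_sum]
    rw [Finset.sum_comm, Finset.sum_comm (s := Finset.univ)]
    refine Finset.sum_congr rfl fun v _ => ?_
    have hc : ∀ ω ω', ω ∩ R = ω' ∩ R →
        Real.log (condProb m R v ω / p) - Real.log ((1 - condProb m R v ω) / (1 - p)) =
        Real.log (condProb m R v ω' / p) - Real.log ((1 - condProb m R v ω') / (1 - p)) :=
      fun ω ω' h => by rw [condProb_congr m R v h]
    have h2 := sum_mul_condProb hm R v hc
    have e1 : ∀ ω, m ω * ip p (condProb m R v ω) =
        m ω * (Real.log (condProb m R v ω / p) - Real.log ((1 - condProb m R v ω) / (1 - p))) *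
          condProb m R v ω + m ω * Real.log ((1 - condProb m R v ω) / (1 - p)) := fun ω => by
      unfold ip; ring
    have e2 : ∀ ω, m ω * t v ω =
        m ω * (Real.log (condProb m R v ω / p) - Real.log ((1 - condProb m R v ω) / (1 - p))) *
          (if v ∈ ω then 1 else 0) + m ω * Real.log ((1 - condProb m R v ω) / (1 - p)) :=
      fun ω => by simp only [ht]; ring
    rw [Finset.sum_congr rfl fun ω _ => e1 ω, Finset.sum_congr rfl fun ω _ => e2 ω,
      Finset.sum_add_distrib, Finset.sum_add_distrib, h2]
  have h2 : ∀ ω, m ω * ∑ v ∈ Rᶜ, t v ω ≤ ν ω * P - m ω - m ω * Real.log P := by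
    intro ω
    rcases (hm ω).eq_or_lt with h0 | hpos
    · rw [← h0]; simpa using mul_nonneg (hν0 ω) hP.le
    have hpw : 0 < pw (fun _ => p) ω := pw_pos (fun _ => hp) ω
    set F : V → ℝ := fun v => if v ∈ R then 1 else
      if v ∈ ω then condProb m R v ω / p else (1 - condProb m R v ω) / (1 - p) with hF
    have hFpos : ∀ v, 0 < F v := by
      intro v
      by_cases hv : v ∈ R
      · simp [hF, hv]
      · by_cases hvω : v ∈ ω
        · simp only [hF, if_neg hv, if_pos hvω]
          exact div_pos (condProb_pos hm hpos hvω) hp.1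
        · simp only [hF, if_neg hv, if_neg hvω]
          exact div_pos (sub_pos.2 ((hqp v (Finset.mem_compl.2 hv) ω).trans_lt hp.2)) hp1
    have hνF : ν ω = (∏ v, F v) * pw (fun _ => p) ω := by
      simp only [hν]
      rw [pw_eq_prod, pw_eq_prod, ← Finset.prod_mul_distrib]
      refine Finset.prod_congr rfl fun v _ => ?_
      by_cases hv : v ∈ R
      · simp [hF, hv]
      · by_cases hvω : v ∈ ω
        · simp only [hF, if_neg hv, if_pos hvω]
          rw [div_mul_cancel₀ _ hp.1.ne']
        · simp only [hF, if_neg hv, if_neg hvω]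
          rw [div_mul_cancel₀ _ hp1.ne']
    have hlog : ∑ v ∈ Rᶜ, t v ω = Real.log (∏ v, F v) := by
      rw [Real.log_prod fun v _ => (hFpos v).ne']
      rw [← Finset.sum_subset (Finset.subset_univ Rᶜ)]
      · refine Finset.sum_congr rfl fun v hv => ?_
        have hv' := Finset.mem_compl.1 hv
        by_cases hvω : v ∈ ω <;> simp [ht, hF, hv', hvω]
      · intro v _ hv
        have hv' : v ∈ R := by simpa using hv
        simp [hF, hv']
    have hprod : 0 < ∏ v, F v := Finset.prod_pos fun v _ => hFpos v
    have h3 := Real.log_le_sub_one_of_pos (mul_pos hprod hP)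
    rw [Real.log_mul hprod.ne' hP.ne'] at h3
    rw [hlog, hνF, ← hmp ω hpos.ne']
    have := mul_le_mul_of_nonneg_left h3 hpos.le
    linarith
  rw [h1]
  refine (Finset.sum_le_sum fun ω _ => h2 ω).trans (le_of_eq ?_)
  rw [Finset.sum_sub_distrib, Finset.sum_sub_distrib, ← Finset.sum_mul, ← Finset.sum_mul]
  have : ∑ ω, ν ω = 1 := sum_pw_condProb m p R
  rw [this, ← hPdef]
  ring

end RelativeEntropy

section QuasiIndependence

lemma sq_sum_weight_mul_le {α : Type*} (s : Finset α) {w : α → ℝ} (hw : ∀ x ∈ s, 0 ≤ w x)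
    (a b : α → ℝ) :
    (∑ x ∈ s, w x * (a x * b x)) ^ 2 ≤ (∑ x ∈ s, w x * a x ^ 2) * ∑ x ∈ s, w x * b x ^ 2 := by
  have h := Finset.sum_mul_sq_le_sq_mul_sq s (fun x => √(w x) * a x) (fun x => √(w x) * b x)
  have e1 : ∀ c : α → ℝ, ∑ x ∈ s, (√(w x) * c x) ^ 2 = ∑ x ∈ s, w x * c x ^ 2 := fun c =>
    Finset.sum_congr rfl fun x hx => by rw [mul_pow, Real.sq_sqrt (hw x hx)]
  rw [e1, e1] at h
  refine le_of_eq_of_le ?_ h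
  congr 1
  refine Finset.sum_congr rfl fun x hx => ?_
  have := Real.mul_self_sqrt (hw x hx)
  linear_combination (-(a x * b x)) * this

variable {V : Type*} [DecidableEq V] {ι : Type*} {r : ℕ}

/-- The vertices of the edge `T φ` that precede position `i`. -/
def initSeg (T : ι → Fin r → V) (φ : ι) (i : Fin r) : Finset V :=
  (Finset.Iio i).image (T φ)

lemma card_initSeg {T : ι → Fin r → V} {φ : ι} (hT : Function.Injective (T φ)) (i : Fin r) :
    (initSeg T φ i).card = i := by
  rw [initSeg, Finset.card_image_of_injective _ hT, Fin.card_Iio]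

lemma notMem_initSeg {T : ι → Fin r → V} {φ : ι} (hT : Function.Injective (T φ)) (i : Fin r) :
    T φ i ∉ initSeg T φ i := by
  intro h
  obtain ⟨k, hk, hki⟩ := Finset.mem_image.1 h
  exact (Finset.mem_Iio.1 hk).ne (hT hki)

variable [Fintype V] [Fintype ι]

lemma sum_sq_count_le {m : Finset V → ℝ} {p : ℝ} (hp : 0 ≤ p)
    (hdown : ∀ (v : V) ω, v ∉ ω → (1 - p) * m (insert v ω) ≤ p * m ω) {σ : ℝ} (hσ : 0 ≤ σ)
    (T : ι → Fin r → V) (i : Fin r) :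
    ∑ S : Finset V, ∑ ω : Finset V, ∑ v, pw (fun _ => σ) S * m ω *
      (∑ φ, if T φ i = v ∧ initSeg T φ i ⊆ S ∧ initSeg T φ i ⊆ ω then 1 else 0) ^ 2 ≤
    (∑ φ, ∑ φ', if T φ i = T φ' i then
      (σ * p) ^ (initSeg T φ i ∪ initSeg T φ' i).card else 0) * ∑ ω, m ω := by
  have h1 : ∀ S ω : Finset V, ∑ v, pw (fun _ => σ) S * m ω *
      (∑ φ, if T φ i = v ∧ initSeg T φ i ⊆ S ∧ initSeg T φ i ⊆ ω then 1 else 0) ^ 2 =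
      ∑ φ, ∑ φ', (if T φ i = T φ' i then
        (pw (fun _ => σ) S * (if initSeg T φ i ∪ initSeg T φ' i ⊆ S then 1 else 0)) *
        (m ω * (if initSeg T φ i ∪ initSeg T φ' i ⊆ ω then 1 else 0)) else 0) := by
    intro S ω
    simp only [sq]
    simp only [Finset.sum_mul_sum]
    simp only [Finset.mul_sum]
    rw [Finset.sum_comm]
    refine Finset.sum_congr rfl fun φ _ => ?_
    rw [Finset.sum_comm]
    refine Finset.sum_congr rfl fun φ' _ => ?_
    rw [Finset.sum_eq_single (T φ i)]
    · by_cases e1 : T φ i = T φ' i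
      · by_cases e2 : initSeg T φ i ⊆ S <;> by_cases e3 : initSeg T φ i ⊆ ω <;>
        by_cases e4 : initSeg T φ' i ⊆ S <;> by_cases e5 : initSeg T φ' i ⊆ ω <;>
        simp [e1, e2, e3, e4, e5, Finset.union_subset_iff]
      · rw [if_neg e1, if_neg (fun h : T φ' i = T φ i ∧ _ => e1 h.1.symm)]; ring
    · intro v _ hv
      rw [if_neg (fun h : T φ i = v ∧ _ => hv h.1.symm)]; ring
    · simp
  simp only [h1]
  have h2 : ∑ S : Finset V, ∑ ω : Finset V, ∑ φ, ∑ φ', (if T φ i = T φ' i then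
        (pw (fun _ => σ) S * (if initSeg T φ i ∪ initSeg T φ' i ⊆ S then 1 else 0)) *
        (m ω * (if initSeg T φ i ∪ initSeg T φ' i ⊆ ω then 1 else 0)) else 0) =
      ∑ φ, ∑ φ', ∑ S : Finset V, ∑ ω : Finset V, (if T φ i = T φ' i then
        (pw (fun _ => σ) S * (if initSeg T φ i ∪ initSeg T φ' i ⊆ S then 1 else 0)) *
        (m ω * (if initSeg T φ i ∪ initSeg T φ' i ⊆ ω then 1 else 0)) else 0) := by
    rw [Finset.sum_congr rfl fun S _ => Finset.sum_comm, Finset.sum_comm]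
    refine Finset.sum_congr rfl fun φ _ => ?_
    rw [Finset.sum_congr rfl fun S _ => Finset.sum_comm, Finset.sum_comm]
  rw [h2, Finset.sum_mul]
  refine Finset.sum_le_sum fun φ _ => ?_
  rw [Finset.sum_mul]
  refine Finset.sum_le_sum fun φ' _ => ?_
  by_cases h : T φ i = T φ' i
  · simp only [if_pos h]
    rw [← Finset.sum_mul_sum, sum_pw_superset, Finset.prod_const, mul_pow, mul_assoc]
    exact mul_le_mul_of_nonneg_left (sum_superset_le hp hdown _) (pow_nonneg hσ _)
  · simp [h]

set_option maxHeartbeats 1000000 in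
lemma hybrid_error_sq_le {m : Finset V → ℝ} (hm : ∀ ω, 0 ≤ m ω) {p : ℝ} (hp : 0 ≤ p)
    (hdown : ∀ (v : V) ω, v ∉ ω → (1 - p) * m (insert v ω) ≤ p * m ω) {σ : ℝ}
    (hσ : σ ∈ Set.Icc (0 : ℝ) 1) {T : ι → Fin r → V} (hT : ∀ φ, Function.Injective (T φ))
    {R : Finset V} {𝓖 : Finset ι} (h𝓖 : ∀ φ ∈ 𝓖, ∀ k, T φ k ∉ R) {g : Finset V → ℝ}
    (hg : ∀ ω ω', ω ∩ R = ω' ∩ R → g ω = g ω') (hg0 : ∀ ω, 0 ≤ g ω) (hg1 : ∀ ω, g ω ≤ 1)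
    (i : Fin r) :
    (σ ^ (i : ℕ) * (1 - σ) * ∑ φ ∈ 𝓖, ∑ ω, m ω *
      (g ω * (if initSeg T φ i ⊆ ω then 1 else 0) *
        ∏ k ∈ Finset.Ioi i, condProb m R (T φ k) ω) *
      (condProb m R (T φ i) ω - if T φ i ∈ ω then 1 else 0)) ^ 2 ≤
    (∑ S : Finset V, pw (fun _ => σ) S * (energy m (R ∪ S) - energy m R)) *
      (p ^ (2 * (r - 1 - i)) * ((∑ φ, ∑ φ', if T φ i = T φ' i then
        (σ * p) ^ (initSeg T φ i ∪ initSeg T φ' i).card else 0) * ∑ ω, m ω)) := by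
  have hpw0 : ∀ S : Finset V, 0 ≤ pw (fun _ => σ) S := fun S => pw_nonneg (fun _ => hσ) S
  set f : ι → Finset V → ℝ := fun φ ω => g ω * (if initSeg T φ i ⊆ ω then 1 else 0) *
    ∏ k ∈ Finset.Ioi i, condProb m R (T φ k) ω with hf
  have hf0 : ∀ φ ω, 0 ≤ f φ ω := fun φ ω => mul_nonneg
    (mul_nonneg (hg0 ω) (by split_ifs <;> simp))
    (Finset.prod_nonneg fun k _ => condProb_nonneg hm _ _ _)
  have hfle : ∀ φ ∈ 𝓖, ∀ ω, f φ ω ≤ (if initSeg T φ i ⊆ ω then 1 else 0) * p ^ (r - 1 - i) := by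
    intro φ hφ ω
    have h1 : ∏ k ∈ Finset.Ioi i, condProb m R (T φ k) ω ≤ p ^ (r - 1 - i) := by
      refine (Finset.prod_le_prod (fun k _ => condProb_nonneg hm _ _ _)
        (fun k _ => condProb_le hm hp hdown (h𝓖 φ hφ k) ω)).trans ?_
      rw [Finset.prod_const, Fin.card_Ioi]
    refine mul_le_mul ?_ h1 (Finset.prod_nonneg fun k _ => condProb_nonneg hm _ _ _)
      (by split_ifs <;> simp)
    exact mul_le_of_le_one_left (by split_ifs <;> simp) (hg1 ω)
  set w : Finset V → Finset V → V → ℝ := fun S ω v =>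
    ∑ φ ∈ 𝓖, if T φ i = v ∧ initSeg T φ i ⊆ S then f φ ω else 0 with hw
  set d : Finset V → Finset V → V → ℝ := fun S ω v =>
    if v ∈ R ∪ S then 0 else condProb m R v ω - condProb m (R ∪ S) v ω with hd
  -- replacing the indicator by its conditional probability given `R ∪ S`
  have hA : ∀ S, ∀ φ ∈ 𝓖, initSeg T φ i ⊆ S → T φ i ∉ S →
      ∑ ω, m ω * f φ ω * (condProb m R (T φ i) ω - if T φ i ∈ ω then 1 else 0) =
      ∑ ω, m ω * f φ ω * d S ω (T φ i) := by
    intro S φ hφ hS hiS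
    have hmeas : ∀ ω ω', ω ∩ (R ∪ S) = ω' ∩ (R ∪ S) → f φ ω = f φ ω' := by
      intro ω ω' h
      have hR : ω ∩ R = ω' ∩ R := by
        rw [← Finset.inter_eq_right.2 (Finset.subset_union_left (s₁ := R) (s₂ := S)),
          ← Finset.inter_assoc, ← Finset.inter_assoc, h]
      have hB : initSeg T φ i ⊆ ω ↔ initSeg T φ i ⊆ ω' := by
        have hBU : initSeg T φ i ⊆ R ∪ S := hS.trans Finset.subset_union_right
        constructor
        · intro h1
          exact (Finset.subset_inter h1 hBU).trans (h ▸ Finset.inter_subset_left)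
        · intro h1
          exact (Finset.subset_inter h1 hBU).trans (h ▸ Finset.inter_subset_left)
      simp only [hf, hg _ _ hR, hB, condProb_congr m R _ hR]
    have h1 := sum_mul_condProb hm (R ∪ S) (T φ i) hmeas
    have hni : T φ i ∉ R ∪ S := by simp [h𝓖 φ hφ i, hiS]
    simp only [hd, if_neg hni, mul_sub, Finset.sum_sub_distrib, h1]
  have hB : σ ^ (i : ℕ) * (1 - σ) * ∑ φ ∈ 𝓖, ∑ ω, m ω * f φ ω *
      (condProb m R (T φ i) ω - if T φ i ∈ ω then 1 else 0) =
      ∑ S : Finset V, ∑ ω : Finset V, ∑ v, pw (fun _ => σ) S * m ω * (d S ω v * w S ω v) := by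
    have e1 : ∀ S ω : Finset V, ∑ v, pw (fun _ => σ) S * m ω * (d S ω v * w S ω v) =
        ∑ φ ∈ 𝓖, pw (fun _ => σ) S * (if initSeg T φ i ⊆ S then 1 else 0) *
          (m ω * f φ ω * d S ω (T φ i)) := by
      intro S ω
      simp only [hw, Finset.mul_sum]
      rw [Finset.sum_comm]
      refine Finset.sum_congr rfl fun φ _ => ?_
      rw [Finset.sum_eq_single (T φ i)]
      · by_cases hS : initSeg T φ i ⊆ S <;> simp [hS]; ring
      · intro v _ hv
        rw [if_neg (fun h : T φ i = v ∧ _ => hv h.1.symm)]; ring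
      · simp
    simp only [e1]
    rw [Finset.mul_sum, Finset.sum_congr rfl fun S _ => Finset.sum_comm, Finset.sum_comm]
    refine Finset.sum_congr rfl fun φ hφ => ?_
    have e2 := sum_pw_superset_notMem (fun _ => σ) (notMem_initSeg (hT φ) i)
    rw [Finset.prod_const, card_initSeg (hT φ)] at e2
    rw [← e2, Finset.sum_mul]
    refine Finset.sum_congr rfl fun S _ => ?_
    rw [← Finset.mul_sum]
    by_cases hS : initSeg T φ i ⊆ S
    · by_cases hi : T φ i ∈ S
      · have : ∀ ω, d S ω (T φ i) = 0 := fun ω => if_pos (by simp [hi])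
        simp [hi, this]
      · rw [hA S φ hφ hS hi]; simp [hS, hi]
    · simp [hS]
  have hC : ∑ S : Finset V, ∑ ω : Finset V, ∑ v, pw (fun _ => σ) S * m ω * d S ω v ^ 2 ≤
      ∑ S : Finset V, pw (fun _ => σ) S * (energy m (R ∪ S) - energy m R) := by
    refine Finset.sum_le_sum fun S _ => ?_
    refine le_of_eq_of_le ?_ (mul_le_mul_of_nonneg_left (sum_condProb_sub_sq_le_energy hm
      (Finset.subset_union_left (s₁ := R) (s₂ := S))) (hpw0 S))
    rw [Finset.sum_comm, Finset.mul_sum]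
    refine Finset.sum_congr rfl fun v _ => ?_
    by_cases hv : v ∈ R ∪ S
    · simp only [hd, if_pos hv]; simp
    · simp only [hd, if_neg hv, Finset.mul_sum]
      exact Finset.sum_congr rfl fun ω _ => by ring
  have hD : ∑ S : Finset V, ∑ ω : Finset V, ∑ v, pw (fun _ => σ) S * m ω * w S ω v ^ 2 ≤
      p ^ (2 * (r - 1 - i)) * ((∑ φ, ∑ φ', if T φ i = T φ' i then
        (σ * p) ^ (initSeg T φ i ∪ initSeg T φ' i).card else 0) * ∑ ω, m ω) := by
    refine le_trans ?_ (mul_le_mul_of_nonneg_left (sum_sq_count_le hp hdown hσ.1 T i)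
      (pow_nonneg hp _))
    simp only [Finset.mul_sum (a := p ^ (2 * (r - 1 - (i : ℕ))))]
    refine Finset.sum_le_sum fun S _ => Finset.sum_le_sum fun ω _ => Finset.sum_le_sum fun v _ => ?_
    have hw0 : 0 ≤ w S ω v := Finset.sum_nonneg fun φ _ => by split_ifs <;> simp [hf0]
    have hwle : w S ω v ≤ p ^ (r - 1 - i) *
        ∑ φ, if T φ i = v ∧ initSeg T φ i ⊆ S ∧ initSeg T φ i ⊆ ω then 1 else 0 := by
      rw [Finset.mul_sum]
      refine (Finset.sum_le_sum (g := fun φ => p ^ (r - 1 - (i : ℕ)) * if T φ i = v ∧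
        initSeg T φ i ⊆ S ∧ initSeg T φ i ⊆ ω then 1 else 0) fun φ hφ => ?_).trans
        (Finset.sum_le_sum_of_subset_of_nonneg (Finset.subset_univ 𝓖) fun φ _ _ =>
          mul_nonneg (pow_nonneg hp _) (by split_ifs <;> simp))
      have := hfle φ hφ ω
      by_cases h : T φ i = v ∧ initSeg T φ i ⊆ S
      · rw [if_pos h]
        by_cases h3 : initSeg T φ i ⊆ ω
        · rw [if_pos h3] at this
          rw [if_pos ⟨h.1, h.2, h3⟩]
          linarith
        · rw [if_neg h3] at this
          rw [if_neg fun h' => h3 h'.2.2]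
          linarith
      · rw [if_neg h, if_neg fun h' => h ⟨h'.1, h'.2.1⟩, mul_zero]
    have h1 := pow_le_pow_left₀ hw0 hwle 2
    rw [mul_pow, ← pow_mul, mul_comm _ 2] at h1
    have := mul_le_mul_of_nonneg_left h1 (mul_nonneg (hpw0 S) (hm ω))
    linarith
  rw [hB]
  have hcs := sq_sum_weight_mul_le (Finset.univ : Finset (Finset V × Finset V × V))
    (w := fun x => pw (fun _ => σ) x.1 * m x.2.1) (fun x _ => mul_nonneg (hpw0 _) (hm _))
    (fun x => d x.1 x.2.1 x.2.2) (fun x => w x.1 x.2.1 x.2.2)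
  simp only [Fintype.sum_prod_type] at hcs
  refine hcs.trans (mul_le_mul hC hD ?_ ?_)
  · exact Finset.sum_nonneg fun S _ => Finset.sum_nonneg fun ω _ => Finset.sum_nonneg fun v _ =>
      mul_nonneg (mul_nonneg (hpw0 S) (hm ω)) (sq_nonneg _)
  · refine le_trans ?_ hC
    exact Finset.sum_nonneg fun S _ => Finset.sum_nonneg fun ω _ => Finset.sum_nonneg fun v _ =>
      mul_nonneg (mul_nonneg (hpw0 S) (hm ω)) (sq_nonneg _)

end QuasiIndependence

section LowerTail

lemma prod_sub_prod_eq_sum {r : ℕ} (q a : Fin r → ℝ) :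
    ∏ k, q k - ∏ k, a k =
      ∑ i, (∏ k ∈ Finset.Iio i, a k) * (∏ k ∈ Finset.Ioi i, q k) * (q i - a i) := by
  have h := Finset.prod_sub_ordered Finset.univ q (fun k => q k - a k)
  simp only [sub_sub_cancel] at h
  rw [h, sub_sub_cancel]
  refine Finset.sum_congr rfl fun i _ => ?_
  have e1 : Finset.univ.filter (fun k => k < i) = Finset.Iio i := by ext; simp
  have e2 : Finset.univ.filter (fun k => i < k) = Finset.Ioi i := by ext; simp
  rw [e1, e2]; ring

variable {V : Type*} [DecidableEq V] {ι : Type*} {r : ℕ}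

lemma prod_ite_mem_eq (T : ι → Fin r → V) (φ : ι) (s : Finset (Fin r)) (ω : Finset V) :
    ∏ k ∈ s, (if T φ k ∈ ω then (1 : ℝ) else 0) = if s.image (T φ) ⊆ ω then 1 else 0 := by
  by_cases h : s.image (T φ) ⊆ ω
  · rw [if_pos h]
    exact Finset.prod_eq_one fun k hk => if_pos (h (Finset.mem_image_of_mem _ hk))
  · rw [if_neg h]
    obtain ⟨v, hv, hvω⟩ := Finset.not_subset.1 h
    obtain ⟨k, hk, rfl⟩ := Finset.mem_image.1 hv
    exact Finset.prod_eq_zero hk (if_neg hvω)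

variable [Fintype V] [Fintype ι]

/-- There is a set `R` meeting few edges such that revealing the configuration on a further
random set of density `σ` barely increases the energy. -/
lemma exists_energy_stable {m : Finset V → ℝ} (hm : ∀ ω, 0 ≤ m ω) {p : ℝ} (hp : 0 < p)
    (hdown : ∀ (v : V) ω, v ∉ ω → (1 - p) * m (insert v ω) ≤ p * m ω)
    (hP : 0 < ∑ ω, m ω) (T : ι → Fin r → V) (hE : 0 < Fintype.card ι) (hN : 0 < Fintype.card V)
    {σ ε : ℝ} (hσ : σ ∈ Set.Icc (0 : ℝ) 1) (hε : 0 < ε) :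
    ∃ R : Finset V, (∑ φ, ∑ k, if T φ k ∈ R then (1 : ℝ) else 0) ≤ ε * Fintype.card ι ∧
      ε * (∑ S : Finset V, pw (fun _ => σ) S * (energy m (R ∪ S) - energy m R)) ≤
        Fintype.card V * p ^ 2 * (∑ ω, m ω) * (r * σ) := by
  set P := ∑ ω, m ω
  set E : ℝ := (Fintype.card ι : ℝ)
  set N : ℝ := (Fintype.card V : ℝ)
  have hE0 : 0 < E := Nat.cast_pos.2 hE
  have hN0 : 0 < N := Nat.cast_pos.2 hN
  set bad : Finset V → ℝ := fun R => ∑ φ, ∑ k, if T φ k ∈ R then (1 : ℝ) else 0 with hbad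
  have hc : 0 < N * p ^ 2 * P := by positivity
  obtain ⟨R, -, hR⟩ := Finset.exists_max_image (Finset.univ : Finset (Finset V))
    (fun R => ε * E * energy m R - N * p ^ 2 * P * bad R) ⟨∅, Finset.mem_univ _⟩
  refine ⟨R, ?_, ?_⟩
  · have h1 := hR ∅ (Finset.mem_univ _)
    have h2 : bad ∅ = 0 := by simp [hbad]
    have h3 := mul_nonneg (mul_nonneg hε.le hE0.le) (energy_nonneg hm ∅)
    have h4 := mul_le_mul_of_nonneg_left (energy_le hm hp.le hdown R) (mul_nonneg hε.le hE0.le)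
    refine le_of_mul_le_mul_left ?_ hc
    simp only [h2, mul_zero, sub_zero] at h1
    change N * p ^ 2 * P * bad R ≤ _
    linarith
  · refine le_of_mul_le_mul_left ?_ hE0
    have hpw0 : ∀ S : Finset V, 0 ≤ pw (fun _ => σ) S := fun S => pw_nonneg (fun _ => hσ) S
    have hS : ∀ S : Finset V, ε * E * (energy m (R ∪ S) - energy m R) ≤
        N * p ^ 2 * P * bad S := by
      intro S
      have h1 := hR (R ∪ S) (Finset.mem_univ _)
      have h2 : bad (R ∪ S) ≤ bad R + bad S := by
        simp only [hbad, ← Finset.sum_add_distrib]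
        refine Finset.sum_le_sum fun φ _ => Finset.sum_le_sum fun k _ => ?_
        by_cases h : T φ k ∈ R <;> by_cases h' : T φ k ∈ S <;> simp [h, h']
      have h3 := mul_le_mul_of_nonneg_left h2 hc.le
      linarith
    have hsum : ∑ S : Finset V, pw (fun _ => σ) S * bad S = E * (r * σ) := by
      have : ∀ S : Finset V, pw (fun _ => σ) S * bad S =
          ∑ φ, ∑ k, pw (fun _ => σ) S * (if T φ k ∈ S then 1 else 0) := fun S => by
        simp only [hbad, Finset.mul_sum]
      simp only [this]
      rw [Finset.sum_comm, Finset.sum_congr rfl fun φ _ => Finset.sum_comm]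
      simp only [sum_pw_mem]
      simp [E]
    calc E * (ε * ∑ S : Finset V, pw (fun _ => σ) S * (energy m (R ∪ S) - energy m R))
        = ∑ S : Finset V, pw (fun _ => σ) S * (ε * E * (energy m (R ∪ S) - energy m R)) := by
          simp only [Finset.mul_sum]
          exact Finset.sum_congr rfl fun S _ => by ring
      _ ≤ ∑ S : Finset V, pw (fun _ => σ) S * (N * p ^ 2 * P * bad S) :=
          Finset.sum_le_sum fun S _ => mul_le_mul_of_nonneg_left (hS S) (hpw0 S)
      _ = N * p ^ 2 * P * ∑ S : Finset V, pw (fun _ => σ) S * bad S := by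
          rw [Finset.mul_sum (s := Finset.univ) (f := fun S => pw (fun _ => σ) S * bad S)]
          exact Finset.sum_congr rfl fun S _ => by ring
      _ = _ := by rw [hsum]; ring

lemma hybrid_error_le {m : Finset V → ℝ} (hm : ∀ ω, 0 ≤ m ω) {p : ℝ} (hp : 0 < p)
    (hdown : ∀ (v : V) ω, v ∉ ω → (1 - p) * m (insert v ω) ≤ p * m ω)
    {T : ι → Fin r → V} (hT : ∀ φ, Function.Injective (T φ))
    (hN : 0 < Fintype.card V) {σ ε C : ℝ} (hσ : 0 < σ) (hσ2 : σ ≤ 1 / 2) (hε : 0 < ε)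
    (hσC : 4 * r ^ 3 * C * σ ≤ ε ^ 5) (i : Fin r)
    (hC : (∑ φ, ∑ φ', if T φ i = T φ' i then
        (σ * p) ^ (initSeg T φ i ∪ initSeg T φ' i).card else 0) * Fintype.card V ≤
        C * (σ * p) ^ (2 * (i : ℕ)) * (Fintype.card ι : ℝ) ^ 2)
    {R : Finset V} {𝓖 : Finset ι} (h𝓖 : ∀ φ ∈ 𝓖, ∀ k, T φ k ∉ R) {g : Finset V → ℝ}
    (hg : ∀ ω ω', ω ∩ R = ω' ∩ R → g ω = g ω') (hg0 : ∀ ω, 0 ≤ g ω) (hg1 : ∀ ω, g ω ≤ 1)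
    (hR : ε * (∑ S : Finset V, pw (fun _ => σ) S * (energy m (R ∪ S) - energy m R)) ≤
        Fintype.card V * p ^ 2 * (∑ ω, m ω) * (r * σ)) :
    r * (∑ φ ∈ 𝓖, ∑ ω, m ω *
      (g ω * (if initSeg T φ i ⊆ ω then 1 else 0) *
        ∏ k ∈ Finset.Ioi i, condProb m R (T φ k) ω) *
      (condProb m R (T φ i) ω - if T φ i ∈ ω then 1 else 0)) ≤
      ε ^ 2 * ((∑ ω, m ω) * p ^ r * Fintype.card ι) := by
  have h := hybrid_error_sq_le hm hp.le hdown ⟨hσ.le, by linarith⟩ hT h𝓖 hg hg0 hg1 i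
  set X := ∑ φ ∈ 𝓖, ∑ ω, m ω *
      (g ω * (if initSeg T φ i ⊆ ω then 1 else 0) *
        ∏ k ∈ Finset.Ioi i, condProb m R (T φ k) ω) *
      (condProb m R (T φ i) ω - if T φ i ∈ ω then 1 else 0)
  set A := ∑ S : Finset V, pw (fun _ => σ) S * (energy m (R ∪ S) - energy m R)
  set Q := ∑ φ, ∑ φ', if T φ i = T φ' i then
        (σ * p) ^ (initSeg T φ i ∪ initSeg T φ' i).card else 0
  have hP : 0 ≤ ∑ ω, m ω := Finset.sum_nonneg fun ω _ => hm ω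
  set P := ∑ ω, m ω
  set E : ℝ := (Fintype.card ι : ℝ)
  have hN0 : (0 : ℝ) < Fintype.card V := Nat.cast_pos.2 hN
  set N : ℝ := (Fintype.card V : ℝ)
  have hQ0 : 0 ≤ Q := Finset.sum_nonneg fun φ _ => Finset.sum_nonneg fun φ' _ => by
    split_ifs <;> positivity
  have hE0 : 0 ≤ E := Nat.cast_nonneg _
  have hr0 : (0 : ℝ) ≤ r := Nat.cast_nonneg _
  -- combine the bounds
  have hexp : p ^ 2 * p ^ (2 * (r - 1 - (i : ℕ))) * p ^ (2 * (i : ℕ)) = (p ^ r) ^ 2 := by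
    rw [← pow_add, ← pow_add, ← pow_mul]
    congr 1
    have := i.isLt
    omega
  have h1 : ε * ((σ ^ (i : ℕ) * (1 - σ) * X) ^ 2) ≤
      (P * p ^ r * E) ^ 2 * (C * r * σ) * (σ ^ (i : ℕ)) ^ 2 := by
    calc ε * ((σ ^ (i : ℕ) * (1 - σ) * X) ^ 2)
        ≤ ε * (A * (p ^ (2 * (r - 1 - (i : ℕ))) * (Q * P))) :=
          mul_le_mul_of_nonneg_left h hε.le
      _ = (ε * A) * (p ^ (2 * (r - 1 - (i : ℕ))) * (Q * P)) := by ring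
      _ ≤ (N * p ^ 2 * P * (r * σ)) * (p ^ (2 * (r - 1 - (i : ℕ))) * (Q * P)) :=
          mul_le_mul_of_nonneg_right hR (by positivity)
      _ = (p ^ 2 * P * (r * σ) * p ^ (2 * (r - 1 - (i : ℕ))) * P) * (Q * N) := by ring
      _ ≤ (p ^ 2 * P * (r * σ) * p ^ (2 * (r - 1 - (i : ℕ))) * P) *
            (C * (σ * p) ^ (2 * (i : ℕ)) * E ^ 2) :=
          mul_le_mul_of_nonneg_left hC (by positivity)
      _ = (p ^ 2 * p ^ (2 * (r - 1 - (i : ℕ))) * p ^ (2 * (i : ℕ))) * (P * E) ^ 2 *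
            (C * r * σ) * (σ ^ (i : ℕ)) ^ 2 := by
          rw [mul_pow σ p, pow_mul σ 2, ← pow_mul σ (i : ℕ) 2, ← pow_mul σ 2, mul_comm (i : ℕ) 2]
          ring
      _ = _ := by rw [hexp]; ring
  have hσi : 0 < (σ ^ (i : ℕ)) ^ 2 := by positivity
  have h2 : ε * ((1 - σ) * X) ^ 2 ≤ (P * p ^ r * E) ^ 2 * (C * r * σ) := by
    refine le_of_mul_le_mul_right ?_ hσi
    refine le_of_eq_of_le ?_ h1
    ring
  have h3 : X ^ 2 ≤ 4 * ((1 - σ) * X) ^ 2 := by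
    have : (1 : ℝ) ≤ 4 * (1 - σ) ^ 2 := by nlinarith
    calc X ^ 2 = 1 * X ^ 2 := (one_mul _).symm
      _ ≤ 4 * (1 - σ) ^ 2 * X ^ 2 := mul_le_mul_of_nonneg_right this (sq_nonneg _)
      _ = _ := by ring
  have h4 : ε * (r * X) ^ 2 ≤ ε * (ε ^ 2 * (P * p ^ r * E)) ^ 2 := by
    calc ε * (r * X) ^ 2 = r ^ 2 * (ε * X ^ 2) := by ring
      _ ≤ r ^ 2 * (4 * (ε * ((1 - σ) * X) ^ 2)) := by
          refine mul_le_mul_of_nonneg_left ?_ (by positivity)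
          have := mul_le_mul_of_nonneg_left h3 hε.le
          linarith
      _ ≤ r ^ 2 * (4 * ((P * p ^ r * E) ^ 2 * (C * r * σ))) :=
          mul_le_mul_of_nonneg_left (mul_le_mul_of_nonneg_left h2 (by norm_num)) (by positivity)
      _ = (P * p ^ r * E) ^ 2 * (4 * r ^ 3 * C * σ) := by ring
      _ ≤ (P * p ^ r * E) ^ 2 * ε ^ 5 := mul_le_mul_of_nonneg_left hσC (sq_nonneg _)
      _ = _ := by ring
  exact le_of_abs_le (abs_le_of_sq_le_sq (le_of_mul_le_mul_left h4 hε) (by positivity))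

/-- The mean-field lower bound for the lower tail of the number of edges of a hypergraph. -/
theorem exists_product_measure_of_lower_tail {m : Finset V → ℝ} (hm : ∀ ω, 0 ≤ m ω) {p : ℝ}
    (hp : p ∈ Set.Ioo (0 : ℝ) 1)
    (hdown : ∀ (v : V) ω, v ∉ ω → (1 - p) * m (insert v ω) ≤ p * m ω)
    (hmp : ∀ ω, m ω ≠ 0 → m ω = pw (fun _ => p) ω) (hP : 0 < ∑ ω, m ω)
    (hr : 0 < r) {T : ι → Fin r → V} (hT : ∀ φ, Function.Injective (T φ))
    (hE : 0 < Fintype.card ι) (hN : 0 < Fintype.card V)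
    {σ ε C η : ℝ} (hσ : 0 < σ) (hσ2 : σ ≤ 1 / 2) (hε : 0 < ε) (hε1 : ε < 1)
    (hσC : 4 * r ^ 3 * C * σ ≤ ε ^ 5)
    (hC : ∀ i : Fin r, (∑ φ, ∑ φ', if T φ i = T φ' i then
        (σ * p) ^ (initSeg T φ i ∪ initSeg T φ' i).card else 0) * Fintype.card V ≤
        C * (σ * p) ^ (2 * (i : ℕ)) * (Fintype.card ι : ℝ) ^ 2)
    (hX : ∀ ω, m ω ≠ 0 → ∑ φ, ∏ k, (if T φ k ∈ ω then (1 : ℝ) else 0) ≤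
      η * (p ^ r * Fintype.card ι)) :
    ∃ q : V → ℝ, (∀ v, q v ∈ Set.Icc (0 : ℝ) 1) ∧
      ∑ φ, ∏ k, q (T φ k) ≤ (η + 2 * ε) * (p ^ r * Fintype.card ι) ∧
      (1 - ε) * ∑ v, ip p (q v) ≤ - Real.log (∑ ω, m ω) := by
  obtain ⟨R, hbad, hR⟩ := exists_energy_stable hm hp.1 hdown hP T hE hN
    ⟨hσ.le, by linarith⟩ hε
  set P := ∑ ω, m ω with hPdef
  set E : ℝ := (Fintype.card ι : ℝ) with hEdef
  have hE0 : 0 < E := Nat.cast_pos.2 hE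
  have hpr : 0 < p ^ r := pow_pos hp.1 r
  set 𝓖 : Finset ι := Finset.univ.filter fun φ => ∀ k, T φ k ∉ R with h𝓖def
  have h𝓖 : ∀ φ ∈ 𝓖, ∀ k, T φ k ∉ R := fun φ hφ => (Finset.mem_filter.1 hφ).2
  set Y : Finset V → ℝ := fun ω => ∑ φ ∈ 𝓖, ∏ k, condProb m R (T φ k) ω with hY
  have hYc : ∀ ω ω', ω ∩ R = ω' ∩ R → Y ω = Y ω' := fun ω ω' h => by
    simp only [hY, condProb_congr m R _ h]
  set g : Finset V → ℝ := fun ω => if (η + ε) * (p ^ r * E) < Y ω then 1 else 0 with hgdef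
  have hg : ∀ ω ω', ω ∩ R = ω' ∩ R → g ω = g ω' := fun ω ω' h => by
    simp only [hgdef, hYc ω ω' h]
  have hg0 : ∀ ω, 0 ≤ g ω := fun ω => by simp only [hgdef]; split_ifs <;> simp
  have hg1 : ∀ ω, g ω ≤ 1 := fun ω => by simp only [hgdef]; split_ifs <;> simp
  have hr0 : (0 : ℝ) < r := Nat.cast_pos.2 hr
  have htel : ∑ ω, m ω * g ω * (Y ω - ∑ φ ∈ 𝓖, ∏ k, (if T φ k ∈ ω then (1 : ℝ) else 0)) =
      ∑ i : Fin r, ∑ φ ∈ 𝓖, ∑ ω, m ω *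
      (g ω * (if initSeg T φ i ⊆ ω then 1 else 0) *
        ∏ k ∈ Finset.Ioi i, condProb m R (T φ k) ω) *
      (condProb m R (T φ i) ω - if T φ i ∈ ω then 1 else 0) := by
    have e1 : ∀ ω, m ω * g ω * (Y ω - ∑ φ ∈ 𝓖, ∏ k, (if T φ k ∈ ω then (1 : ℝ) else 0)) =
        ∑ i : Fin r, ∑ φ ∈ 𝓖, m ω * (g ω * (if initSeg T φ i ⊆ ω then 1 else 0) *
        ∏ k ∈ Finset.Ioi i, condProb m R (T φ k) ω) *
        (condProb m R (T φ i) ω - if T φ i ∈ ω then 1 else 0) := by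
      intro ω
      rw [Finset.sum_comm]
      simp only [hY]
      rw [← Finset.sum_sub_distrib, Finset.mul_sum]
      refine Finset.sum_congr rfl fun φ _ => ?_
      rw [prod_sub_prod_eq_sum, Finset.mul_sum]
      refine Finset.sum_congr rfl fun i _ => ?_
      rw [prod_ite_mem_eq]
      change _ * (_ * _ * _) = m ω * (g ω * (if (Finset.Iio i).image (T φ) ⊆ ω then 1 else 0) * _) * _
      ring
    rw [Finset.sum_congr rfl fun ω _ => e1 ω, Finset.sum_comm]
    exact Finset.sum_congr rfl fun i _ => Finset.sum_comm
  have hub : ∑ ω, m ω * g ω * (Y ω - ∑ φ ∈ 𝓖, ∏ k, (if T φ k ∈ ω then (1 : ℝ) else 0)) ≤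
      ε ^ 2 * (P * p ^ r * E) := by
    rw [htel]
    refine le_of_mul_le_mul_left ?_ hr0
    rw [Finset.mul_sum]
    refine (Finset.sum_le_sum fun i _ => hybrid_error_le hm hp.1 hdown hT hN hσ hσ2 hε hσC i
      (hC i) h𝓖 hg hg0 hg1 hR).trans (le_of_eq ?_)
    simp [E, P]
  have hlb : ε * (p ^ r * E) * ∑ ω, m ω * g ω ≤
      ∑ ω, m ω * g ω * (Y ω - ∑ φ ∈ 𝓖, ∏ k, (if T φ k ∈ ω then (1 : ℝ) else 0)) := by
    rw [Finset.mul_sum]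
    refine Finset.sum_le_sum fun ω _ => ?_
    by_cases h0 : m ω = 0
    · simp [h0]
    by_cases hB : (η + ε) * (p ^ r * E) < Y ω
    · rw [mul_comm (ε * (p ^ r * E))]
      refine mul_le_mul_of_nonneg_left ?_ (mul_nonneg (hm ω) (hg0 ω))
      have h1 : ∑ φ ∈ 𝓖, ∏ k, (if T φ k ∈ ω then (1 : ℝ) else 0) ≤ η * (p ^ r * E) :=
        (Finset.sum_le_sum_of_subset_of_nonneg (Finset.subset_univ 𝓖) fun φ _ _ =>
          Finset.prod_nonneg fun k _ => by split_ifs <;> simp).trans (hX ω h0)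
      linarith
    · have : g ω = 0 := if_neg hB
      simp [this]
  have hBsmall : ∑ ω, m ω * g ω ≤ ε * P := by
    refine le_of_mul_le_mul_left ?_ (mul_pos hε (mul_pos hpr hE0))
    refine (hlb.trans hub).trans (le_of_eq ?_)
    ring
  have hent := sum_ip_condProb_le hm hp hdown hmp hP R
  rw [← hPdef] at hent
  have hq01 : ∀ v ∉ R, ∀ ω, condProb m R v ω ∈ Set.Icc (0 : ℝ) 1 := fun v hv ω =>
    ⟨condProb_nonneg hm _ _ _, (condProb_le hm hp.1.le hdown hv ω).trans hp.2.le⟩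
  have hI0 : ∀ ω, 0 ≤ ∑ v ∈ Rᶜ, ip p (condProb m R v ω) := fun ω =>
    Finset.sum_nonneg fun v hv => ip_nonneg hp (hq01 v (Finset.mem_compl.1 hv) ω)
  have hD0 : 0 ≤ - Real.log P := by
    refine le_of_mul_le_mul_left ?_ hP
    rw [mul_zero]
    exact (Finset.sum_nonneg fun ω _ => mul_nonneg (hm ω) (hI0 ω)).trans hent
  obtain ⟨ω, hω1, hω2⟩ : ∃ ω, Y ω ≤ (η + ε) * (p ^ r * E) ∧
      (1 - ε) * ∑ v ∈ Rᶜ, ip p (condProb m R v ω) ≤ - Real.log P := by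
    by_contra! hcon
    have h1 : ∑ ω, m ω * (1 - g ω) * (- Real.log P) <
        ∑ ω, m ω * (1 - g ω) * ((1 - ε) * ∑ v ∈ Rᶜ, ip p (condProb m R v ω)) := by
      have hle : ∀ ω, m ω * (1 - g ω) * (- Real.log P) ≤
          m ω * (1 - g ω) * ((1 - ε) * ∑ v ∈ Rᶜ, ip p (condProb m R v ω)) := by
        intro ω
        by_cases hB : (η + ε) * (p ^ r * E) < Y ω
        · have : g ω = 1 := if_pos hB
          simp [this]
        · exact mul_le_mul_of_nonneg_left (hcon ω (not_lt.1 hB)).le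
            (mul_nonneg (hm ω) (sub_nonneg.2 (hg1 ω)))
      refine Finset.sum_lt_sum (fun ω _ => hle ω) ?_
      have hpos : 0 < ∑ ω, m ω * (1 - g ω) := by
        have : ∑ ω, m ω * (1 - g ω) = P - ∑ ω, m ω * g ω := by
          rw [hPdef, ← Finset.sum_sub_distrib]
          exact Finset.sum_congr rfl fun ω _ => by ring
        rw [this]
        have := mul_lt_mul_of_pos_right hε1 hP
        linarith
      obtain ⟨ω, hω, hlt⟩ := Finset.exists_lt_of_sum_lt (s := Finset.univ) (f := fun _ => (0 : ℝ))
        (by simpa using hpos)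
      refine ⟨ω, hω, ?_⟩
      have hB : Y ω ≤ (η + ε) * (p ^ r * E) := by
        by_contra hB
        have : g ω = 1 := if_pos (not_le.1 hB)
        simp [this] at hlt
      exact mul_lt_mul_of_pos_left (hcon ω hB) hlt
    have h2 : ∑ ω, m ω * (1 - g ω) * ((1 - ε) * ∑ v ∈ Rᶜ, ip p (condProb m R v ω)) ≤
        (1 - ε) * (P * (- Real.log P)) := by
      refine le_trans ?_ (mul_le_mul_of_nonneg_left hent (sub_nonneg.2 hε1.le))
      rw [Finset.mul_sum]
      refine Finset.sum_le_sum fun ω _ => ?_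
      have h3 : m ω * (1 - g ω) ≤ m ω := mul_le_of_le_one_right (hm ω) (by linarith [hg0 ω])
      have := mul_le_mul_of_nonneg_right h3 (mul_nonneg (sub_nonneg.2 hε1.le) (hI0 ω))
      linarith
    have h3 : (1 - ε) * (P * (- Real.log P)) ≤ ∑ ω, m ω * (1 - g ω) * (- Real.log P) := by
      rw [← Finset.sum_mul, ← mul_assoc]
      refine mul_le_mul_of_nonneg_right ?_ hD0
      have : ∑ ω, m ω * (1 - g ω) = P - ∑ ω, m ω * g ω := by
        rw [hPdef, ← Finset.sum_sub_distrib]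
        exact Finset.sum_congr rfl fun ω _ => by ring
      rw [this]; linarith
    linarith
  set q : V → ℝ := fun v => if v ∈ R then p else condProb m R v ω with hq
  have hqI : ∀ v, q v ∈ Set.Icc (0 : ℝ) 1 := fun v => by
    by_cases hv : v ∈ R
    · simp only [hq, if_pos hv]; exact ⟨hp.1.le, hp.2.le⟩
    · simp only [hq, if_neg hv]; exact hq01 v hv ω
  have hqp : ∀ v, q v ≤ p := fun v => by
    by_cases hv : v ∈ R
    · simp only [hq, if_pos hv]; exact le_rfl
    · simp only [hq, if_neg hv]; exact condProb_le hm hp.1.le hdown hv ω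
  refine ⟨q, hqI, ?_, ?_⟩
  · rw [← Finset.sum_filter_add_sum_filter_not Finset.univ (fun φ => ∀ k, T φ k ∉ R)]
    have h1 : ∑ φ ∈ 𝓖, ∏ k, q (T φ k) = Y ω := Finset.sum_congr rfl fun φ hφ =>
      Finset.prod_congr rfl fun k _ => if_neg (h𝓖 φ hφ k)
    have h2 : ∑ φ with ¬ ∀ k, T φ k ∉ R, ∏ k, q (T φ k) ≤ ε * E * p ^ r := by
      refine le_trans ?_ (mul_le_mul_of_nonneg_right hbad hpr.le)
      rw [Finset.sum_mul]
      refine (Finset.sum_le_sum (g := fun φ => (∑ k, if T φ k ∈ R then (1 : ℝ) else 0) * p ^ r)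
        fun φ hφ => ?_).trans (Finset.sum_le_sum_of_subset_of_nonneg (Finset.subset_univ _)
          fun φ _ _ => mul_nonneg (Finset.sum_nonneg fun k _ => by split_ifs <;> simp) hpr.le)
      obtain ⟨k, hk⟩ := not_forall.1 (Finset.mem_filter.1 hφ).2
      have hk' : T φ k ∈ R := not_not.1 hk
      have h3 : (1 : ℝ) ≤ ∑ k, if T φ k ∈ R then (1 : ℝ) else 0 := by
        refine le_of_eq_of_le ?_ (Finset.single_le_sum (f := fun k => if T φ k ∈ R then (1 : ℝ)
          else 0) (fun k _ => by split_ifs <;> simp) (Finset.mem_univ k))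
        simp [hk']
      have h4 : ∏ k, q (T φ k) ≤ p ^ r := by
        refine (Finset.prod_le_prod (fun k _ => (hqI _).1) (fun k _ => hqp _)).trans ?_
        simp
      exact h4.trans (le_mul_of_one_le_left hpr.le h3)
    rw [h1]
    linarith
  · refine le_trans (mul_le_mul_of_nonneg_left (le_of_eq ?_) (sub_nonneg.2 hε1.le)) hω2
    rw [← Finset.sum_subset (Finset.subset_univ Rᶜ)]
    · exact Finset.sum_congr rfl fun v hv => by simp only [hq, if_neg (Finset.mem_compl.1 hv)]
    · intro v _ hv
      have hv' : v ∈ R := by simpa using hv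
      simp only [hq, if_pos hv', ip_self hp]

end LowerTail

section Tilting

variable {V : Type*} [Fintype V] [DecidableEq V]

lemma sum_pw_mul_sq_eq (q a : V → ℝ) :
    ∑ ω : Finset V, pw q ω * (∑ v, a v * ((if v ∈ ω then 1 else 0) - q v)) ^ 2 =
      ∑ v, a v ^ 2 * (q v * (1 - q v)) := by
  have key : ∀ u v, ∑ ω : Finset V, pw q ω *
      (((if u ∈ ω then 1 else 0) - q u) * ((if v ∈ ω then 1 else 0) - q v)) =
      if u = v then q v * (1 - q v) else 0 := by
    intro u v
    have e : ∑ ω : Finset V, pw q ω *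
        (((if u ∈ ω then 1 else 0) - q u) * ((if v ∈ ω then 1 else 0) - q v)) =
        ∑ ω : Finset V, pw q ω * ((if u ∈ ω then 1 else 0) * (if v ∈ ω then 1 else 0)) -
        q v * ∑ ω : Finset V, pw q ω * (if u ∈ ω then 1 else 0) -
        q u * ∑ ω : Finset V, pw q ω * (if v ∈ ω then 1 else 0) +
        q u * q v * ∑ ω : Finset V, pw q ω := by
      simp only [Finset.mul_sum, ← Finset.sum_sub_distrib, ← Finset.sum_add_distrib]
      exact Finset.sum_congr rfl fun ω _ => by ring
    rw [e, sum_pw, sum_pw_mem, sum_pw_mem]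
    by_cases h : u = v
    · subst h
      have : ∑ ω : Finset V, pw q ω * ((if u ∈ ω then 1 else 0) * (if u ∈ ω then 1 else 0)) =
          q u := by
        rw [← sum_pw_mem q u]
        exact Finset.sum_congr rfl fun ω _ => by split_ifs <;> simp
      rw [this, if_pos rfl]; ring
    · rw [sum_pw_mem_mem q h, if_neg h]; ring
  calc _ = ∑ ω : Finset V, ∑ u, ∑ v, a u * a v * (pw q ω *
        (((if u ∈ ω then 1 else 0) - q u) * ((if v ∈ ω then 1 else 0) - q v))) := by
        refine Finset.sum_congr rfl fun ω _ => ?_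
        rw [sq, Finset.sum_mul_sum, Finset.mul_sum]
        refine Finset.sum_congr rfl fun u _ => ?_
        rw [Finset.mul_sum]
        exact Finset.sum_congr rfl fun v _ => by ring
    _ = ∑ u, ∑ v, a u * a v * (if u = v then q v * (1 - q v) else 0) := by
        rw [Finset.sum_comm]
        refine Finset.sum_congr rfl fun u _ => ?_
        rw [Finset.sum_comm]
        refine Finset.sum_congr rfl fun v _ => ?_
        rw [← key u v, Finset.mul_sum]
    _ = _ := by
        refine Finset.sum_congr rfl fun u _ => ?_
        simp only [mul_ite, mul_zero, Finset.sum_ite_eq, Finset.mem_univ, if_true]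
        ring

/-- Change of measure from `pw q` to `pw p`, with the fluctuation of the log-likelihood ratio
controlled by its second moment. -/
lemma exp_mul_sub_le_sum_pw {p : ℝ} (hp : p ∈ Set.Ioo (0 : ℝ) 1) {q : V → ℝ}
    (hq : ∀ v, 0 ≤ q v) (hqp : ∀ v, q v ≤ p) (D : Finset V → Prop) [DecidablePred D] {t : ℝ}
    (ht : 0 < t) :
    Real.exp (-(∑ v, ip p (q v) + t)) * ((∑ ω, if D ω then pw q ω else 0) -
      (∑ v, (Real.log (q v / p) - Real.log ((1 - q v) / (1 - p))) ^ 2 * (q v * (1 - q v))) /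
        t ^ 2) ≤ ∑ ω, if D ω then pw (fun _ => p) ω else 0 := by
  set a : V → ℝ := fun v => Real.log (q v / p) - Real.log ((1 - q v) / (1 - p)) with ha
  set K := ∑ v, ip p (q v) with hK
  have hq1 : ∀ v, q v ∈ Set.Icc (0 : ℝ) 1 := fun v => ⟨hq v, (hqp v).trans hp.2.le⟩
  set Z : Finset V → ℝ := fun ω => ∑ v, a v * ((if v ∈ ω then 1 else 0) - q v) with hZ
  have hp1 : 0 < 1 - p := sub_pos.2 hp.2
  have hlik : ∀ ω, pw q ω ≠ 0 → pw (fun _ => p) ω = pw q ω * Real.exp (-(K + Z ω)) := by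
    intro ω hω
    rw [pw_eq_prod] at hω
    have hne := fun v => Finset.prod_ne_zero_iff.1 hω v (Finset.mem_univ v)
    have h1 : K + Z ω = ∑ v, if v ∈ ω then Real.log (q v / p)
        else Real.log ((1 - q v) / (1 - p)) := by
      rw [hK, hZ, ← Finset.sum_add_distrib]
      refine Finset.sum_congr rfl fun v _ => ?_
      by_cases hv : v ∈ ω
      · simp only [hv, if_true, ha, ip]; ring
      · simp only [hv, if_false, ha, ip]; ring
    rw [h1, ← Finset.sum_neg_distrib, Real.exp_sum, pw_eq_prod, pw_eq_prod,
      ← Finset.prod_mul_distrib]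
    refine Finset.prod_congr rfl fun v _ => ?_
    have h2 := hne v
    by_cases hv : v ∈ ω
    · simp only [hv, if_true] at h2 ⊢
      have h3 : 0 < q v := lt_of_le_of_ne (hq v) (Ne.symm h2)
      rw [Real.exp_neg, Real.exp_log (div_pos h3 hp.1)]
      field_simp
    · simp only [hv, if_false] at h2 ⊢
      have h3 : 0 < 1 - q v := by linarith [hqp v]
      rw [Real.exp_neg, Real.exp_log (div_pos h3 hp1)]
      field_simp
  have hvar : (∑ v, a v ^ 2 * (q v * (1 - q v))) / t ^ 2 =
      ∑ ω : Finset V, pw q ω * (Z ω ^ 2 / t ^ 2) := by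
    rw [← sum_pw_mul_sq_eq, Finset.sum_div]
    exact Finset.sum_congr rfl fun ω _ => by rw [hZ]; ring
  rw [hvar, ← Finset.sum_sub_distrib, Finset.mul_sum]
  refine Finset.sum_le_sum fun ω _ => ?_
  have h0 : 0 ≤ pw q ω := pw_nonneg hq1 ω
  have h0' : 0 ≤ pw (fun _ => p) ω := (pw_pos (fun _ => hp) ω).le
  have hz : 0 ≤ Z ω ^ 2 / t ^ 2 := by positivity
  have hexp := Real.exp_pos (-(K + t))
  by_cases hD : D ω
  · simp only [if_pos hD]
    by_cases hZt : Z ω ≤ t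
    · by_cases hne : pw q ω = 0
      · rw [hne]; simpa using h0'
      · rw [hlik ω hne, mul_comm]
        refine mul_le_mul ?_ (Real.exp_le_exp.2 (by linarith)) hexp.le h0
        linarith [mul_nonneg h0 hz]
    · have h1 : 1 ≤ Z ω ^ 2 / t ^ 2 := by
        rw [one_le_div (by positivity)]
        exact pow_le_pow_left₀ ht.le (not_le.1 hZt).le 2
      refine le_trans (mul_nonpos_of_nonneg_of_nonpos hexp.le ?_) h0'
      linarith [mul_le_mul_of_nonneg_left h1 h0]
  · simp only [if_neg hD]
    refine mul_nonpos_of_nonneg_of_nonpos hexp.le ?_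
    linarith [mul_nonneg h0 hz]

lemma log_div_sub_log_div_sq_mul_le {p p₀ q : ℝ} (hp : 0 < p) (hp₀ : p ≤ p₀) (hp₀1 : p₀ < 1)
    (hq : 0 ≤ q) (hqp : q ≤ p) :
    (Real.log (q / p) - Real.log ((1 - q) / (1 - p))) ^ 2 * (q * (1 - q)) ≤
      (8 + 2 * Real.log (1 - p₀) ^ 2) * p := by
  rcases hq.eq_or_lt with rfl | hq0
  · simp only [zero_mul, mul_zero]; positivity
  have h1 : Real.log (q / p) ^ 2 * q ≤ 4 * p := by
    have hx : 0 < q / p := div_pos hq0 hp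
    have h := Real.abs_log_mul_self_rpow_lt (q / p) (1 / 2) hx ((div_le_one hp).2 hqp)
      (by norm_num)
    rw [← Real.sqrt_eq_rpow] at h
    have h2 : (Real.log (q / p) * √(q / p)) ^ 2 ≤ 2 ^ 2 := by
      rw [← sq_abs]
      exact pow_le_pow_left₀ (abs_nonneg _) (h.le.trans (by norm_num)) 2
    rw [mul_pow, Real.sq_sqrt hx.le] at h2
    calc Real.log (q / p) ^ 2 * q = Real.log (q / p) ^ 2 * (q / p) * p := by field_simp
      _ ≤ 4 * p := mul_le_mul_of_nonneg_right (h2.trans (by norm_num)) hp.le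
  have hp1 : 0 < 1 - p := by linarith
  have h2 : Real.log ((1 - q) / (1 - p)) ^ 2 ≤ Real.log (1 - p₀) ^ 2 := by
    rw [← neg_sq (Real.log (1 - p₀))]
    refine pow_le_pow_left₀ (Real.log_nonneg ((one_le_div hp1).2 (by linarith))) ?_ 2
    rw [Real.log_div (by linarith) hp1.ne']
    have e1 : Real.log (1 - q) ≤ 0 := Real.log_nonpos (by linarith) (by linarith)
    have e2 : Real.log (1 - p₀) ≤ Real.log (1 - p) :=
      Real.log_le_log (by linarith) (by linarith)
    linarith
  set x := Real.log (q / p)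
  set y := Real.log ((1 - q) / (1 - p))
  have h3 : (x - y) ^ 2 ≤ 2 * x ^ 2 + 2 * y ^ 2 := by nlinarith [sq_nonneg (x + y)]
  calc (x - y) ^ 2 * (q * (1 - q)) ≤ (x - y) ^ 2 * q :=
        mul_le_mul_of_nonneg_left (mul_le_of_le_one_right hq (by linarith)) (sq_nonneg _)
    _ ≤ (2 * x ^ 2 + 2 * y ^ 2) * q := mul_le_mul_of_nonneg_right h3 hq
    _ = 2 * (x ^ 2 * q) + 2 * (y ^ 2 * q) := by ring
    _ ≤ 2 * (4 * p) + 2 * (Real.log (1 - p₀) ^ 2 * p) := by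
        have := mul_le_mul h2 hqp hq (sq_nonneg _)
        linarith
    _ = _ := by ring

variable {ι : Type*} [Fintype ι] {r : ℕ}

lemma pow_sub_prod_le {p : ℝ} (hp : 0 ≤ p) (a : Fin r → ℝ) (ha : ∀ k, 0 ≤ a k)
    (hap : ∀ k, a k ≤ p) : p ^ r - ∏ k, a k ≤ p ^ (r - 1) * ∑ k, (p - a k) := by
  have h := prod_sub_prod_eq_sum (fun _ : Fin r => p) a
  rw [Finset.prod_const, Finset.card_univ, Fintype.card_fin] at h
  rw [h, Finset.mul_sum]
  refine Finset.sum_le_sum fun i _ => mul_le_mul_of_nonneg_right ?_ (sub_nonneg.2 (hap i))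
  have h1 : ∏ k ∈ Finset.Iio i, a k ≤ p ^ (i : ℕ) := by
    refine (Finset.prod_le_prod (fun k _ => ha k) (fun k _ => hap k)).trans (le_of_eq ?_)
    simp
  have h2 : p ^ (r - 1) = p ^ (i : ℕ) * p ^ (r - 1 - i) := by
    rw [← pow_add]; congr 1; have := i.isLt; omega
  rw [h2, Finset.prod_const, Fin.card_Ioi]
  exact mul_le_mul_of_nonneg_right h1 (by positivity)

/-- A product measure with few edges has large relative entropy. -/
lemma sq_mul_le_sum_ip {T : ι → Fin r → V} {p : ℝ} (hp : p ∈ Set.Ioo (0 : ℝ) 1) (hr : 0 < r)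
    (hE : 0 < Fintype.card ι) (hN : 0 < Fintype.card V) {C ε : ℝ} (hC : 1 ≤ C) (hε : 0 < ε)
    (hε1 : ε ≤ 1)
    (hdeg : ∀ v, (∑ φ, ∑ k, if T φ k = v then (1 : ℝ) else 0) * Fintype.card V ≤
      C * Fintype.card ι)
    {q : V → ℝ} (hq : ∀ v, 0 ≤ q v) (hqp : ∀ v, q v ≤ p)
    (hfeas : ∑ φ, ∏ k, q (T φ k) ≤ (1 - ε) * (p ^ r * Fintype.card ι)) :
    (ε / C) ^ 2 / 4 * (p * Fintype.card V) ≤ ∑ v, ip p (q v) := by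
  have hE0 : (0 : ℝ) < Fintype.card ι := Nat.cast_pos.2 hE
  have hN0 : (0 : ℝ) < Fintype.card V := Nat.cast_pos.2 hN
  have hC0 : 0 < C := by linarith
  have hpr : 0 < p ^ (r - 1) := pow_pos hp.1 _
  have h1 : ε * (p ^ r * Fintype.card ι) ≤
      p ^ (r - 1) * ∑ φ, ∑ k, (p - q (T φ k)) := by
    have : ∑ φ : ι, (p ^ r - ∏ k, q (T φ k)) ≤ ∑ φ, p ^ (r - 1) * ∑ k, (p - q (T φ k)) :=
      Finset.sum_le_sum fun φ _ => pow_sub_prod_le hp.1.le _ (fun k => hq _) (fun k => hqp _)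
    rw [Finset.sum_sub_distrib, ← Finset.mul_sum] at this
    simp only [Finset.sum_const, Finset.card_univ, nsmul_eq_mul] at this
    linarith
  have h2 : ∑ φ, ∑ k, (p - q (T φ k)) =
      ∑ v, (∑ φ, ∑ k, if T φ k = v then (1 : ℝ) else 0) * (p - q v) := by
    simp only [Finset.sum_mul]
    symm
    rw [Finset.sum_comm]
    refine Finset.sum_congr rfl fun φ _ => ?_
    rw [Finset.sum_comm]
    refine Finset.sum_congr rfl fun k _ => ?_
    simp
  have h3 : (∑ φ, ∑ k, (p - q (T φ k))) * Fintype.card V ≤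
      C * Fintype.card ι * ∑ v, (p - q v) := by
    rw [h2, Finset.sum_mul, Finset.mul_sum]
    refine Finset.sum_le_sum fun v _ => ?_
    have := mul_le_mul_of_nonneg_right (hdeg v) (sub_nonneg.2 (hqp v))
    linarith
  have h4 : ε / C * (p * Fintype.card V) ≤ ∑ v, (p - q v) := by
    rw [div_mul_eq_mul_div, div_le_iff₀ hC0]
    refine le_of_mul_le_mul_left ?_ (mul_pos hpr hE0)
    have hpp : p ^ r = p ^ (r - 1) * p := by rw [← pow_succ]; congr 1; omega
    calc p ^ (r - 1) * Fintype.card ι * (ε * (p * Fintype.card V))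
        = ε * (p ^ r * Fintype.card ι) * Fintype.card V := by rw [hpp]; ring
      _ ≤ p ^ (r - 1) * (∑ φ, ∑ k, (p - q (T φ k))) * Fintype.card V :=
          mul_le_mul_of_nonneg_right h1 hN0.le
      _ = p ^ (r - 1) * ((∑ φ, ∑ k, (p - q (T φ k))) * Fintype.card V) := by ring
      _ ≤ p ^ (r - 1) * (C * Fintype.card ι * ∑ v, (p - q v)) :=
          mul_le_mul_of_nonneg_left h3 hpr.le
      _ = _ := by ring
  set κ := ε / C with hκ
  have hκ0 : 0 < κ := div_pos hε hC0
  have hκ1 : κ ≤ 1 := (div_le_one hC0).2 (hε1.trans hC)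
  have h5 : ∑ v, (p * (κ / 2 - (κ / 2) ^ 2) - κ / 2 * q v) ≤ ∑ v, ip p (q v) := by
    refine Finset.sum_le_sum fun v _ => ?_
    refine le_trans ?_ (ip_ge hp ⟨hq v, (hqp v).trans hp.2.le⟩ (κ / 2))
    have h6 := Real.abs_exp_sub_one_sub_id_le (x := -(κ / 2))
      (by rw [abs_neg, abs_of_pos (by positivity)]; linarith)
    have h7 := (abs_le.1 h6).2
    have h8 : κ / 2 - (κ / 2) ^ 2 ≤ 1 - Real.exp (-(κ / 2)) := by linarith
    linarith [mul_le_mul_of_nonneg_left h8 hp.1.le]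
  refine le_trans ?_ h5
  have h6 : ∑ v, (p * (κ / 2 - (κ / 2) ^ 2) - κ / 2 * q v) =
      κ / 2 * (∑ v, (p - q v)) - (κ / 2) ^ 2 * (p * Fintype.card V) := by
    rw [Finset.sum_sub_distrib, Finset.sum_sub_distrib, ← Finset.mul_sum Finset.univ q]
    simp only [Finset.sum_const, Finset.card_univ, nsmul_eq_mul]
    ring
  rw [h6]
  have := mul_le_mul_of_nonneg_left h4 (by positivity : 0 ≤ κ / 2)
  linarith

lemma sum_pw_mul_sum_prod_ite {T : ι → Fin r → V} (hT : ∀ φ, Function.Injective (T φ))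
    (q : V → ℝ) :
    ∑ ω : Finset V, pw q ω * ∑ φ, ∏ k, (if T φ k ∈ ω then (1 : ℝ) else 0) =
      ∑ φ, ∏ k, q (T φ k) := by
  simp only [Finset.mul_sum]
  rw [Finset.sum_comm]
  refine Finset.sum_congr rfl fun φ _ => ?_
  simp only [prod_ite_mem_eq]
  rw [sum_pw_superset, Finset.prod_image fun k _ k' _ h => hT φ h]

/-- The mean-field upper bound for the lower tail of the number of edges of a hypergraph. -/
theorem neg_log_lower_tail_le {T : ι → Fin r → V} (hT : ∀ φ, Function.Injective (T φ))
    (hr : 0 < r) (hE : 0 < Fintype.card ι) (hN : 0 < Fintype.card V)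
    {p p₀ ε η C : ℝ} (hp : 0 < p) (hp₀ : p ≤ p₀) (hp₀1 : p₀ < 1) (hε : 0 < ε)
    (hε1 : ε ≤ 1 / 2) (hη : 0 ≤ η) (hη1 : η ≤ 1) (hC : 1 ≤ C)
    (hdeg : ∀ v, (∑ φ, ∑ k, if T φ k = v then (1 : ℝ) else 0) * Fintype.card V ≤
      C * Fintype.card ι)
    (hbig : 128 * (8 + 2 * Real.log (1 - p₀) ^ 2) * C ^ 4 ≤ ε ^ 7 * (p * Fintype.card V))
    {q : V → ℝ} (hq : ∀ v, q v ∈ Set.Icc (0 : ℝ) 1)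
    (hfeas : ∑ φ, ∏ k, q (T φ k) ≤ (1 - ε) * η * (p ^ r * Fintype.card ι)) :
    - Real.log (∑ ω : Finset V, if ∑ φ, ∏ k, (if T φ k ∈ ω then (1 : ℝ) else 0) ≤
      η * (p ^ r * Fintype.card ι) then pw (fun _ => p) ω else 0) ≤
      (1 + ε) * ∑ v, ip p (q v) := by
  have hpI : p ∈ Set.Ioo (0 : ℝ) 1 := ⟨hp, hp₀.trans_lt hp₀1⟩
  wlog hqp : ∀ v, q v ≤ p generalizing q with H
  · have hmin : ∀ v, min (q v) p ∈ Set.Icc (0 : ℝ) 1 := fun v =>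
      ⟨le_min (hq v).1 hp.le, (min_le_left _ _).trans (hq v).2⟩
    refine (H hmin (le_trans (Finset.sum_le_sum fun φ _ => Finset.prod_le_prod
      (fun k _ => (hmin _).1) fun k _ => min_le_left _ _) hfeas) fun v => min_le_right _ _).trans ?_
    refine mul_le_mul_of_nonneg_left (Finset.sum_le_sum fun v _ => ?_) (by linarith)
    rcases le_total (q v) p with h | h
    · rw [min_eq_left h]
    · rw [min_eq_right h, ip_self hpI]; exact ip_nonneg hpI (hq v)
  have hE0 : (0 : ℝ) < Fintype.card ι := Nat.cast_pos.2 hE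
  have hN0 : (0 : ℝ) < Fintype.card V := Nat.cast_pos.2 hN
  have hC0 : 0 < C := by linarith
  have hμ : 0 < p ^ r * Fintype.card ι := mul_pos (pow_pos hp r) hE0
  set μ := p ^ r * (Fintype.card ι : ℝ) with hμdef
  set X : Finset V → ℝ := fun ω => ∑ φ, ∏ k, (if T φ k ∈ ω then (1 : ℝ) else 0) with hXdef
  have hX0 : ∀ ω, 0 ≤ X ω := fun ω => Finset.sum_nonneg fun φ _ =>
    Finset.prod_nonneg fun k _ => by split_ifs <;> simp
  have hmean : ∑ ω, pw q ω * X ω ≤ (1 - ε) * (η * μ) := by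
    rw [sum_pw_mul_sum_prod_ite hT]; linarith
  have hpw0 := fun ω => pw_nonneg hq ω
  have hQ : ε ≤ ∑ ω, if X ω ≤ η * μ then pw q ω else 0 := by
    have hsplit : ∑ ω, (if X ω ≤ η * μ then pw q ω else 0) =
        1 - ∑ ω, if X ω ≤ η * μ then 0 else pw q ω := by
      rw [← sum_pw q, ← Finset.sum_sub_distrib]
      exact Finset.sum_congr rfl fun ω _ => by split_ifs <;> simp
    rw [hsplit]
    rcases (mul_nonneg hη hμ.le).eq_or_lt with h0 | h0
    · have hz : ∀ ω ∈ Finset.univ, pw q ω * X ω = 0 := by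
        rw [← Finset.sum_eq_zero_iff_of_nonneg fun ω _ => mul_nonneg (hpw0 ω) (hX0 ω)]
        refine le_antisymm (hmean.trans ?_) (Finset.sum_nonneg fun ω _ =>
          mul_nonneg (hpw0 ω) (hX0 ω))
        rw [← h0, mul_zero]
      have : ∑ ω, (if X ω ≤ η * μ then 0 else pw q ω) = 0 := by
        refine Finset.sum_eq_zero fun ω hω => ?_
        split_ifs with h
        · rfl
        · rw [← h0, not_le] at h
          exact (mul_eq_zero.1 (hz ω hω)).resolve_right h.ne'
      rw [this]; linarith
    · have : (∑ ω, if X ω ≤ η * μ then 0 else pw q ω) * (η * μ) ≤ (1 - ε) * (η * μ) := by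
        refine le_trans ?_ hmean
        rw [Finset.sum_mul]
        refine Finset.sum_le_sum fun ω _ => ?_
        split_ifs with h
        · rw [zero_mul]; exact mul_nonneg (hpw0 ω) (hX0 ω)
        · exact mul_le_mul_of_nonneg_left (not_le.1 h).le (hpw0 ω)
      linarith [le_of_mul_le_mul_right this h0]
  have hK := sq_mul_le_sum_ip hpI hr hE hN hC hε (by linarith) hdeg (fun v => (hq v).1) hqp
    (hfeas.trans (mul_le_mul_of_nonneg_right
      (mul_le_of_le_one_right (by linarith) hη1) hμ.le))
  set K := ∑ v, ip p (q v) with hKdef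
  set M := p * (Fintype.card V : ℝ) with hM
  set B := 8 + 2 * Real.log (1 - p₀) ^ 2 with hB
  have hB8 : 8 ≤ B := by rw [hB]; nlinarith [sq_nonneg (Real.log (1 - p₀))]
  have hM0 : 0 < M := mul_pos hp hN0
  set k := (ε / C) ^ 2 / 4 with hk
  have hk0 : 0 < k := by positivity
  have hK0 : 0 < K := lt_of_lt_of_le (mul_pos hk0 hM0) hK
  have hbig' : 8 * B ≤ ε ^ 3 * k ^ 2 * M := by
    refine le_of_mul_le_mul_left ?_ (by positivity : 0 < 16 * C ^ 4)
    calc 16 * C ^ 4 * (8 * B) = 128 * B * C ^ 4 := by ring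
      _ ≤ ε ^ 7 * M := hbig
      _ = _ := by rw [hk]; field_simp; ring
  have ht : 0 < ε * K / 2 := by positivity
  have hvar : (∑ v, (Real.log (q v / p) - Real.log ((1 - q v) / (1 - p))) ^ 2 *
      (q v * (1 - q v))) / (ε * K / 2) ^ 2 ≤ ε / 2 := by
    rw [div_le_iff₀ (by positivity)]
    have h1 : ∑ v, (Real.log (q v / p) - Real.log ((1 - q v) / (1 - p))) ^ 2 *
      (q v * (1 - q v)) ≤ B * M := by
      refine (Finset.sum_le_sum fun v _ => log_div_sub_log_div_sq_mul_le hp hp₀ hp₀1 (hq v).1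
        (hqp v)).trans (le_of_eq ?_)
      simp only [Finset.sum_const, Finset.card_univ, nsmul_eq_mul]
      ring
    refine h1.trans ?_
    have h2 : (k * M) ^ 2 ≤ K ^ 2 := pow_le_pow_left₀ (by positivity) hK 2
    calc B * M = 8 * B * M / 8 := by ring
      _ ≤ ε ^ 3 * k ^ 2 * M * M / 8 := by
          have := mul_le_mul_of_nonneg_right hbig' hM0.le
          linarith
      _ = ε ^ 3 / 8 * (k * M) ^ 2 := by ring
      _ ≤ ε ^ 3 / 8 * K ^ 2 := mul_le_mul_of_nonneg_left h2 (by positivity)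
      _ = _ := by ring
  have hlog : Real.log (2 / ε) ≤ ε * K / 2 := by
    have h1 : Real.log (2 / ε) ≤ 2 / ε :=
      (Real.log_le_sub_one_of_pos (by positivity)).trans (by linarith)
    refine h1.trans ?_
    rw [div_le_iff₀ hε]
    have hk1 : k ≤ 1 := by
      have : ε / C ≤ 1 := (div_le_one hC0).2 (by linarith)
      have := pow_le_one₀ (n := 2) (by positivity) this
      rw [hk]; linarith
    have h2 : ε ^ 3 * k ^ 2 * M ≤ ε ^ 2 * K := by
      calc ε ^ 3 * k ^ 2 * M = ε * k * (ε ^ 2 * (k * M)) := by ring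
        _ ≤ 1 * (ε ^ 2 * K) := by
            refine mul_le_mul ?_ (mul_le_mul_of_nonneg_left hK (by positivity)) (by positivity)
              zero_le_one
            exact mul_le_one₀ (by linarith) hk0.le hk1
        _ = _ := one_mul _
    nlinarith
  have hmain := exp_mul_sub_le_sum_pw hpI (fun v => (hq v).1) hqp (fun ω => X ω ≤ η * μ) ht
  rw [← hKdef] at hmain
  have hlow : Real.exp (-(K + ε * K / 2)) * (ε / 2) ≤
      ∑ ω, if X ω ≤ η * μ then pw (fun _ => p) ω else 0 := by
    refine le_trans (mul_le_mul_of_nonneg_left ?_ (Real.exp_pos _).le) hmain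
    linarith
  have hpos : 0 < Real.exp (-(K + ε * K / 2)) * (ε / 2) := by positivity
  have := Real.log_le_log hpos hlow
  rw [Real.log_mul (Real.exp_pos _).ne' (by positivity), Real.log_exp] at this
  have h3 : Real.log (2 / ε) = - Real.log (ε / 2) := by rw [← Real.log_inv, inv_div]
  linarith

end Tilting

section Embeddings

lemma pow_le_two_pow_mul_card_embedding {α : Type*} [Fintype α] {n : ℕ} (hn : 2 * Fintype.card α ≤ n) :
    n ^ Fintype.card α ≤ 2 ^ Fintype.card α * Fintype.card (α ↪ Fin n) := by
  rw [Fintype.card_embedding_eq, Fintype.card_fin]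
  refine le_trans ?_ (Nat.mul_le_mul_left _ (Nat.pow_sub_le_descFactorial n (Fintype.card α)))
  rw [← mul_pow]
  exact Nat.pow_le_pow_left (by omega) _

lemma card_sEdge_le (n s : ℕ) : Fintype.card (SEdge n s) ≤ n ^ s := by
  rw [Fintype.card_finset_len, Fintype.card_fin]
  exact Nat.choose_le_pow n s

lemma pow_le_card_sEdge {n s : ℕ} (hn : 2 * s ≤ n) :
    n ^ s ≤ 2 ^ s * s.factorial * Fintype.card (SEdge n s) := by
  rw [Fintype.card_finset_len, Fintype.card_fin, mul_assoc,
    ← Nat.descFactorial_eq_factorial_mul_choose]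
  refine le_trans ?_ (Nat.mul_le_mul_left _ (Nat.pow_sub_le_descFactorial n s))
  rw [← mul_pow]
  exact Nat.pow_le_pow_left (by omega) _

lemma card_initSeg_union {V ι : Type*} [DecidableEq V] {r : ℕ} {T : ι → Fin r → V}
    (hT : ∀ φ, Function.Injective (T φ)) (φ φ' : ι) (i : Fin r) :
    (initSeg T φ i ∪ initSeg T φ' i).card +
      ((Finset.Iio i).filter fun l => T φ' l ∈ initSeg T φ i).card = 2 * i := by
  have h1 : ((Finset.Iio i).filter fun l => T φ' l ∈ initSeg T φ i).card =
      (initSeg T φ i ∩ initSeg T φ' i).card := by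
    rw [← Finset.card_image_of_injective _ (hT φ')]
    congr 1
    ext v
    simp only [Finset.mem_image, Finset.mem_filter, Finset.mem_inter]
    constructor
    · rintro ⟨l, ⟨hl, hm⟩, rfl⟩
      exact ⟨hm, Finset.mem_image_of_mem _ hl⟩
    · rintro ⟨h, h'⟩
      obtain ⟨l, hl, rfl⟩ := Finset.mem_image.1 h'
      exact ⟨l, ⟨hl, h⟩, rfl⟩
  rw [h1, Finset.card_union_add_card_inter, card_initSeg (hT φ), card_initSeg (hT φ'), two_mul]

variable {β : Type*} {𝓗 : Finset (Finset β)} {s : ℕ}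

/-- The `k`-th edge of the copy of `𝓗` given by the embedding `φ`. -/
def edgeEmb (hunif : ∀ A ∈ 𝓗, A.card = s) (n : ℕ) (φ : β ↪ Fin n) (k : Fin 𝓗.card) : SEdge n s :=
  ⟨(𝓗.equivFin.symm k : Finset β).map φ, by
    rw [Finset.card_map]; exact hunif _ (𝓗.equivFin.symm k).2⟩

lemma edgeEmb_injective (hunif : ∀ A ∈ 𝓗, A.card = s) (n : ℕ) (φ : β ↪ Fin n) :
    Function.Injective (edgeEmb hunif n φ) := fun k k' h => by
  have h1 := Finset.map_injective φ (congrArg Subtype.val h)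
  exact 𝓗.equivFin.symm.injective (Subtype.ext h1)

variable [DecidableEq β]

/-- The union of the edges of `𝓗` with indices in `J`. -/
def edgeSpan (𝓗 : Finset (Finset β)) (J : Finset (Fin 𝓗.card)) : Finset β :=
  J.biUnion fun k => (𝓗.equivFin.symm k : Finset β)

lemma le_card_edgeSpan (hunif : ∀ A ∈ 𝓗, A.card = s) {J : Finset (Fin 𝓗.card)}
    (hJ : J.Nonempty) : s ≤ (edgeSpan 𝓗 J).card := by
  obtain ⟨k, hk⟩ := hJ
  rw [← hunif _ (𝓗.equivFin.symm k).2]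
  exact Finset.card_le_card (Finset.subset_biUnion_of_mem
    (fun k => (𝓗.equivFin.symm k : Finset β)) hk)

lemma card_image_edge (J : Finset (Fin 𝓗.card)) :
    (J.image fun k => (𝓗.equivFin.symm k : Finset β)).card = J.card :=
  Finset.card_image_of_injective _ fun _ _ h => 𝓗.equivFin.symm.injective (Subtype.ext h)

lemma lt_card_biUnion (hunif : ∀ A ∈ 𝓗, A.card = s) {𝓕 : Finset (Finset β)} (h𝓕 : 𝓕 ⊆ 𝓗)
    (h2 : 2 ≤ 𝓕.card) : s < (𝓕.biUnion id).card := by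
  obtain ⟨A, hA, B, hB, hAB⟩ := Finset.one_lt_card.1 h2
  have hsub : ∀ D ∈ 𝓕, D ⊆ 𝓕.biUnion id := fun D hD => Finset.subset_biUnion_of_mem id hD
  by_contra hle
  have heq : ∀ D ∈ 𝓕, D = 𝓕.biUnion id := fun D hD =>
    Finset.eq_of_subset_of_card_le (hsub D hD) (by rw [hunif D (h𝓕 hD)]; omega)
  exact hAB ((heq A hA).trans (heq B hB).symm)

variable [Fintype β]

lemma copyCountH_eq (hunif : ∀ A ∈ 𝓗, A.card = s) (n : ℕ) (ω : Finset (SEdge n s)) :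
    (copyCountH 𝓗 n s ω : ℝ) =
      ∑ φ, ∏ k, (if edgeEmb hunif n φ k ∈ ω then (1 : ℝ) else 0) := by
  unfold copyCountH
  rw [Finset.card_filter, Nat.cast_sum]
  refine Finset.sum_congr rfl fun φ _ => ?_
  have hiff : (∀ A ∈ 𝓗, ∀ h : (A.map φ).card = s, (⟨A.map φ, h⟩ : SEdge n s) ∈ ω) ↔
      ∀ k, edgeEmb hunif n φ k ∈ ω := by
    constructor
    · exact fun h k => h _ (𝓗.equivFin.symm k).2 _
    · intro h A hA hc
      have := h (𝓗.equivFin ⟨A, hA⟩)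
      simpa only [edgeEmb, Equiv.symm_apply_apply] using this
  by_cases hk : ∀ k, edgeEmb hunif n φ k ∈ ω
  · rw [if_pos (hiff.2 hk), Finset.prod_eq_one fun k _ => if_pos (hk k), Nat.cast_one]
  · rw [if_neg (mt hiff.1 hk)]
    obtain ⟨k, hk⟩ := not_forall.1 hk
    rw [Finset.prod_eq_zero (Finset.mem_univ k) (if_neg hk), Nat.cast_zero]

lemma expCopyH_eq (hunif : ∀ A ∈ 𝓗, A.card = s) (n : ℕ) (q : SEdge n s → ℝ) :
    expCopyH 𝓗 n s q = ∑ φ, ∏ k, q (edgeEmb hunif n φ k) := by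
  unfold expCopyH
  rw [← sum_pw_mul_sum_prod_ite (edgeEmb_injective hunif n)]
  simp only [copyCountH_eq hunif]

lemma expCopyH_const (hunif : ∀ A ∈ 𝓗, A.card = s) (n : ℕ) (p : ℝ) :
    expCopyH 𝓗 n s (fun _ => p) = p ^ 𝓗.card * Fintype.card (β ↪ Fin n) := by
  rw [expCopyH_eq hunif]
  simp [mul_comm]

lemma card_filter_forall_mem_le {n : ℕ} (B : Finset β) (U : Finset (Fin n)) :
    (Finset.univ.filter fun φ : β ↪ Fin n => ∀ x ∈ B, φ x ∈ U).card ≤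
      U.card ^ B.card * n ^ (Fintype.card β - B.card) := by
  have h : (Finset.univ.filter fun φ : β ↪ Fin n => ∀ x ∈ B, φ x ∈ U).card ≤
      (Fintype.piFinset fun x : β => if x ∈ B then U else Finset.univ).card := by
    refine Finset.card_le_card_of_injOn (fun φ => (φ : β → Fin n)) ?_
      (DFunLike.coe_injective.injOn)
    intro φ hφ
    have hφ' := (Finset.mem_filter.1 hφ).2
    rw [Finset.mem_coe, Fintype.mem_piFinset]
    intro x
    split_ifs with hx
    · exact hφ' x hx
    · exact Finset.mem_univ _
  refine h.trans (le_of_eq ?_)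
  rw [Fintype.card_piFinset, ← Finset.prod_mul_prod_compl B, ← Finset.card_compl]
  congr 1
  · rw [Finset.prod_congr rfl fun x hx => by rw [if_pos hx], Finset.prod_const]
  · rw [Finset.prod_congr rfl fun x hx => by rw [if_neg (Finset.mem_compl.1 hx)],
      Finset.prod_const, Finset.card_univ, Fintype.card_fin]

lemma card_filter_edgeEmb_eq_le (hunif : ∀ A ∈ 𝓗, A.card = s) {n : ℕ} (k : Fin 𝓗.card)
    (v : SEdge n s) :
    (Finset.univ.filter fun φ : β ↪ Fin n => edgeEmb hunif n φ k = v).card ≤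
      s ^ s * n ^ (Fintype.card β - s) := by
  have h := card_filter_forall_mem_le (𝓗.equivFin.symm k : Finset β) v.1
  rw [hunif _ (𝓗.equivFin.symm k).2, v.2] at h
  refine le_trans (Finset.card_le_card fun φ hφ => ?_) h
  rw [Finset.mem_filter] at hφ ⊢
  refine ⟨hφ.1, fun x hx => ?_⟩
  rw [← hφ.2]
  exact Finset.mem_map_of_mem φ hx

lemma degree_edgeEmb_le (hunif : ∀ A ∈ 𝓗, A.card = s) (h𝓗 : 𝓗.Nonempty) {n : ℕ}
    (hn : 2 * Fintype.card β ≤ n) (v : SEdge n s) :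
    (∑ φ, ∑ k, if edgeEmb hunif n φ k = v then (1 : ℝ) else 0) * Fintype.card (SEdge n s) ≤
      (𝓗.card * s ^ s * 2 ^ Fintype.card β : ℝ) * Fintype.card (β ↪ Fin n) := by
  obtain ⟨A, hA⟩ := h𝓗
  have hsb : s ≤ Fintype.card β := hunif A hA ▸ Finset.card_le_univ A
  have h1 : (∑ φ : β ↪ Fin n, ∑ k, if edgeEmb hunif n φ k = v then (1 : ℝ) else 0) =
      ((∑ k, (Finset.univ.filter fun φ : β ↪ Fin n => edgeEmb hunif n φ k = v).card : ℕ) : ℝ) := by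
    rw [Finset.sum_comm, Nat.cast_sum]
    exact Finset.sum_congr rfl fun k _ => by rw [Finset.sum_boole]
  have h2 : ∑ k, (Finset.univ.filter fun φ : β ↪ Fin n => edgeEmb hunif n φ k = v).card ≤
      𝓗.card * (s ^ s * n ^ (Fintype.card β - s)) := by
    refine (Finset.sum_le_sum fun k _ => card_filter_edgeEmb_eq_le hunif k v).trans (le_of_eq ?_)
    simp
  rw [h1]
  have h3 : 𝓗.card * (s ^ s * n ^ (Fintype.card β - s)) * n ^ s ≤
      𝓗.card * s ^ s * 2 ^ Fintype.card β * Fintype.card (β ↪ Fin n) := by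
    have e : n ^ (Fintype.card β - s) * n ^ s = n ^ Fintype.card β := by
      rw [← pow_add, Nat.sub_add_cancel hsb]
    calc _ = 𝓗.card * s ^ s * (n ^ (Fintype.card β - s) * n ^ s) := by ring
      _ ≤ 𝓗.card * s ^ s * (2 ^ Fintype.card β * Fintype.card (β ↪ Fin n)) := by
          rw [e]; exact Nat.mul_le_mul_left _ (pow_le_two_pow_mul_card_embedding hn)
      _ = _ := by ring
  exact_mod_cast (Nat.mul_le_mul h2 (card_sEdge_le n s)).trans h3

/-- The second-moment bound for pairs of copies sharing their `i`-th edge. -/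
lemma sum_pow_card_initSeg_union_le (hunif : ∀ A ∈ 𝓗, A.card = s) {n : ℕ}
    (hn : 2 * Fintype.card β ≤ n) {x : ℝ} (hx0 : 0 ≤ x)
    (hx : ∀ J : Finset (Fin 𝓗.card),
      1 ≤ x ^ (J.card - 1) * (n : ℝ) ^ ((edgeSpan 𝓗 J).card - s)) (i : Fin 𝓗.card) :
    (∑ φ : β ↪ Fin n, ∑ φ' : β ↪ Fin n, if edgeEmb hunif n φ i = edgeEmb hunif n φ' i then
      x ^ (initSeg (edgeEmb hunif n) φ i ∪ initSeg (edgeEmb hunif n) φ' i).card else 0) *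
      Fintype.card (SEdge n s) ≤
      (2 ^ 𝓗.card * (Fintype.card β : ℝ) ^ Fintype.card β * 2 ^ Fintype.card β) *
        x ^ (2 * (i : ℕ)) * (Fintype.card (β ↪ Fin n) : ℝ) ^ 2 := by
  set T := edgeEmb hunif n with hTdef
  have hT : ∀ φ, Function.Injective (T φ) := edgeEmb_injective hunif n
  set b := Fintype.card β with hb
  have hsb : s ≤ b := hunif _ (𝓗.equivFin.symm i).2 ▸ Finset.card_le_univ _
  have hcount : ∀ (φ : β ↪ Fin n) (J : Finset (Fin 𝓗.card)), J ⊆ Finset.Iio i →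
      ((Finset.univ.filter fun φ' : β ↪ Fin n => T φ i = T φ' i ∧
        (Finset.Iio i).filter (fun l => T φ' l ∈ initSeg T φ i) = J).card : ℝ) *
        x ^ (2 * (i : ℕ) - J.card) ≤ (b : ℝ) ^ b * (n : ℝ) ^ (b - s) * x ^ (2 * (i : ℕ)) := by
    intro φ J hJ
    have hiJ : i ∉ J := fun h => by simpa using hJ h
    have hJi : J.card ≤ i := (Finset.card_le_card hJ).trans (by simp)
    set S := edgeSpan 𝓗 (insert i J) with hS
    have hsS : s ≤ S.card := le_card_edgeSpan hunif (Finset.insert_nonempty i J)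
    have hSb : S.card ≤ b := Finset.card_le_univ _
    have h1 : (Finset.univ.filter fun φ' : β ↪ Fin n => T φ i = T φ' i ∧
        (Finset.Iio i).filter (fun l => T φ' l ∈ initSeg T φ i) = J).card ≤
        b ^ S.card * n ^ (b - S.card) := by
      have h := card_filter_forall_mem_le S (Finset.univ.map φ)
      rw [Finset.card_map, Finset.card_univ] at h
      refine (Finset.card_le_card fun φ' hφ' => ?_).trans h
      rw [Finset.mem_filter] at hφ' ⊢
      refine ⟨hφ'.1, fun y hy => ?_⟩
      obtain ⟨k, hk, hyk⟩ := Finset.mem_biUnion.1 hy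
      have hin : ∃ l, T φ' k = T φ l := by
        rcases Finset.mem_insert.1 hk with rfl | hk
        · exact ⟨k, hφ'.2.1.symm⟩
        · rw [← hφ'.2.2] at hk
          obtain ⟨l, -, hl⟩ := Finset.mem_image.1 (Finset.mem_filter.1 hk).2
          exact ⟨l, hl.symm⟩
      obtain ⟨l, hl⟩ := hin
      have hmem : φ' y ∈ (T φ l).1 := by
        rw [← hl]; exact Finset.mem_map_of_mem φ' hyk
      exact Finset.map_subset_map.2 (Finset.subset_univ _) hmem
    have h2 : b ^ S.card ≤ b ^ b := by
      rcases Nat.eq_zero_or_pos b with h0 | h0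
      · rw [h0] at hSb ⊢; rw [Nat.le_zero.1 hSb]
      · exact Nat.pow_le_pow_right h0 hSb
    have h3 : ((Finset.univ.filter fun φ' : β ↪ Fin n => T φ i = T φ' i ∧
        (Finset.Iio i).filter (fun l => T φ' l ∈ initSeg T φ i) = J).card : ℝ) ≤
        (b : ℝ) ^ b * (n : ℝ) ^ (b - S.card) := by
      exact_mod_cast h1.trans (Nat.mul_le_mul_right _ h2)
    have h4 := hx (insert i J)
    rw [Finset.card_insert_of_notMem hiJ, Nat.add_sub_cancel, ← hS] at h4
    calc _ ≤ (b : ℝ) ^ b * (n : ℝ) ^ (b - S.card) * x ^ (2 * (i : ℕ) - J.card) :=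
          mul_le_mul_of_nonneg_right h3 (by positivity)
      _ ≤ (b : ℝ) ^ b * (n : ℝ) ^ (b - S.card) * x ^ (2 * (i : ℕ) - J.card) *
            (x ^ J.card * (n : ℝ) ^ (S.card - s)) :=
          le_mul_of_one_le_right (by positivity) h4
      _ = (b : ℝ) ^ b * ((n : ℝ) ^ (b - S.card) * (n : ℝ) ^ (S.card - s)) *
            (x ^ (2 * (i : ℕ) - J.card) * x ^ J.card) := by ring
      _ = _ := by
          rw [← pow_add, ← pow_add, Nat.sub_add_cancel (by omega)]
          congr 3
          omega
  have hφ : ∀ φ : β ↪ Fin n, (∑ φ' : β ↪ Fin n, if T φ i = T φ' i then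
      x ^ (initSeg T φ i ∪ initSeg T φ' i).card else 0) ≤
      2 ^ 𝓗.card * ((b : ℝ) ^ b * (n : ℝ) ^ (b - s) * x ^ (2 * (i : ℕ))) := by
    intro φ
    have h1 : ∀ φ' : β ↪ Fin n, (if T φ i = T φ' i then
        x ^ (initSeg T φ i ∪ initSeg T φ' i).card else 0) =
        ∑ J ∈ (Finset.Iio i).powerset, (if T φ i = T φ' i ∧
          (Finset.Iio i).filter (fun l => T φ' l ∈ initSeg T φ i) = J then (1 : ℝ) else 0) *
          x ^ (2 * (i : ℕ) - J.card) := by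
      intro φ'
      have hmem : (Finset.Iio i).filter (fun l => T φ' l ∈ initSeg T φ i) ∈
          (Finset.Iio i).powerset := Finset.mem_powerset.2 (Finset.filter_subset _ _)
      rw [Finset.sum_eq_single_of_mem _ hmem]
      · have h2 := card_initSeg_union hT φ φ' i
        have h3 : (initSeg T φ i ∪ initSeg T φ' i).card = 2 * (i : ℕ) -
            ((Finset.Iio i).filter (fun l => T φ' l ∈ initSeg T φ i)).card := by omega
        rw [h3]
        by_cases h : T φ i = T φ' i <;> simp [h]
      · intro J _ hJ
        rw [if_neg fun h => hJ h.2.symm, zero_mul]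
    rw [Finset.sum_congr rfl fun φ' _ => h1 φ', Finset.sum_comm]
    calc _ ≤ ∑ J ∈ (Finset.Iio i).powerset,
          ((b : ℝ) ^ b * (n : ℝ) ^ (b - s) * x ^ (2 * (i : ℕ))) := by
          refine Finset.sum_le_sum fun J hJ => ?_
          rw [← Finset.sum_mul, Finset.sum_boole]
          exact hcount φ J (Finset.mem_powerset.1 hJ)
      _ = 2 ^ (i : ℕ) * ((b : ℝ) ^ b * (n : ℝ) ^ (b - s) * x ^ (2 * (i : ℕ))) := by
          rw [Finset.sum_const, Finset.card_powerset, Fin.card_Iio, nsmul_eq_mul]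
          push_cast; ring
      _ ≤ _ := mul_le_mul_of_nonneg_right
          (pow_le_pow_right₀ one_le_two i.isLt.le) (by positivity)
  set E := Fintype.card (β ↪ Fin n) with hE
  have hN : (Fintype.card (SEdge n s) : ℝ) ≤ (n : ℝ) ^ s := by exact_mod_cast card_sEdge_le n s
  have hnE : (n : ℝ) ^ b ≤ 2 ^ b * (E : ℝ) := by
    exact_mod_cast pow_le_two_pow_mul_card_embedding hn
  have e : (n : ℝ) ^ (b - s) * (n : ℝ) ^ s = (n : ℝ) ^ b := by
    rw [← pow_add, Nat.sub_add_cancel hsb]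
  calc _ ≤ (E * (2 ^ 𝓗.card * ((b : ℝ) ^ b * (n : ℝ) ^ (b - s) * x ^ (2 * (i : ℕ))))) *
        (n : ℝ) ^ s := by
        refine mul_le_mul ?_ hN (Nat.cast_nonneg _) (by positivity)
        refine (Finset.sum_le_sum fun φ _ => hφ φ).trans (le_of_eq ?_)
        simp [hE]
    _ = E * (2 ^ 𝓗.card * (b : ℝ) ^ b * x ^ (2 * (i : ℕ))) *
        ((n : ℝ) ^ (b - s) * (n : ℝ) ^ s) := by ring
    _ ≤ E * (2 ^ 𝓗.card * (b : ℝ) ^ b * x ^ (2 * (i : ℕ))) * (2 ^ b * (E : ℝ)) := by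
        rw [e]; exact mul_le_mul_of_nonneg_left hnE (by positivity)
    _ = _ := by ring

lemma le_msDensity {𝓕 : Finset (Finset β)} (h𝓕 : 𝓕 ⊆ 𝓗) (h2 : 2 ≤ 𝓕.card) :
    ((𝓕.card : ℝ) - 1) / (((𝓕.biUnion id).card : ℝ) - s) ≤ msDensity 𝓗 s := by
  unfold msDensity
  rw [if_pos (h2.trans (Finset.card_le_card h𝓕))]
  refine le_csSup (Set.Finite.bddAbove ?_) ⟨𝓕, h𝓕, h2, rfl⟩
  refine (Set.finite_range fun 𝓕 : Finset (Finset β) =>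
    ((𝓕.card : ℝ) - 1) / (((𝓕.biUnion id).card : ℝ) - s)).subset ?_
  rintro x ⟨𝓕, -, -, rfl⟩
  exact ⟨𝓕, rfl⟩

lemma one_div_le_msDensity (hunif : ∀ A ∈ 𝓗, A.card = s) :
    1 / (s : ℝ) ≤ msDensity 𝓗 s := by
  by_cases h : 2 ≤ 𝓗.card
  · obtain ⟨𝓕, h𝓕, hc⟩ := Finset.exists_subset_card_eq h
    refine le_trans ?_ (le_msDensity h𝓕 hc.ge)
    have h1 := lt_card_biUnion hunif h𝓕 hc.ge
    have h2 : (𝓕.biUnion id).card ≤ 2 * s := by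
      rw [← hc]
      exact Finset.card_biUnion_le_card_mul _ _ _ fun A hA => (hunif A (h𝓕 hA)).le
    have h1' : (s : ℝ) < (𝓕.biUnion id).card := Nat.cast_lt.2 h1
    have h2' : ((𝓕.biUnion id).card : ℝ) ≤ 2 * s := by exact_mod_cast h2
    rw [hc]
    have h3 : ((2 : ℕ) : ℝ) - 1 = 1 := by norm_num
    rw [h3]
    exact one_div_le_one_div_of_le (by linarith) (by linarith)
  · unfold msDensity
    rw [if_neg h]

lemma one_le_pow_mul_pow_edgeSpan (hs : 1 ≤ s) (hunif : ∀ A ∈ 𝓗, A.card = s) {n : ℕ}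
    (hn : 1 ≤ n) {x : ℝ} (hx : (n : ℝ) ^ (-(1 / msDensity 𝓗 s)) ≤ x)
    (J : Finset (Fin 𝓗.card)) :
    1 ≤ x ^ (J.card - 1) * (n : ℝ) ^ ((edgeSpan 𝓗 J).card - s) := by
  have hn1 : (1 : ℝ) ≤ n := Nat.one_le_cast.2 hn
  have hn0 : (0 : ℝ) < n := by linarith
  rcases Nat.lt_or_ge J.card 2 with h | h
  · have : J.card - 1 = 0 := by omega
    rw [this, pow_zero, one_mul]
    exact one_le_pow₀ hn1
  set 𝓕 := J.image fun k => (𝓗.equivFin.symm k : Finset β) with h𝓕def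
  have h𝓕 : 𝓕 ⊆ 𝓗 := by
    intro A hA
    obtain ⟨k, -, rfl⟩ := Finset.mem_image.1 hA
    exact (𝓗.equivFin.symm k).2
  have hcard : 𝓕.card = J.card := card_image_edge J
  have hspan : 𝓕.biUnion id = edgeSpan 𝓗 J := by
    rw [h𝓕def, Finset.image_biUnion]; rfl
  have hm : 0 < msDensity 𝓗 s :=
    lt_of_lt_of_le (one_div_pos.2 (Nat.cast_pos.2 hs)) (one_div_le_msDensity hunif)
  have hlt := lt_card_biUnion hunif h𝓕 (hcard ▸ h)
  have hle := le_msDensity (s := s) h𝓕 (hcard ▸ h)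
  rw [hspan] at hlt hle
  have hlt' : (0 : ℝ) < (edgeSpan 𝓗 J).card - s := sub_pos.2 (Nat.cast_lt.2 hlt)
  rw [div_le_iff₀ hlt', hcard] at hle
  have hx0 := Real.rpow_pos_of_pos hn0 (-(1 / msDensity 𝓗 s))
  calc (1 : ℝ) = (n : ℝ) ^ (0 : ℝ) := (Real.rpow_zero _).symm
    _ ≤ (n : ℝ) ^ (-(1 / msDensity 𝓗 s) * ((J.card - 1 : ℕ) : ℝ) +
          (((edgeSpan 𝓗 J).card - s : ℕ) : ℝ)) := by
        refine Real.rpow_le_rpow_of_exponent_le hn1 ?_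
        rw [Nat.cast_sub (by omega), Nat.cast_sub hlt.le, Nat.cast_one]
        have : 1 / msDensity 𝓗 s * ((J.card : ℝ) - 1) ≤ (edgeSpan 𝓗 J).card - s := by
          rw [one_div, inv_mul_le_iff₀ hm]
          exact hle
        linarith
    _ = ((n : ℝ) ^ (-(1 / msDensity 𝓗 s))) ^ (J.card - 1) *
          (n : ℝ) ^ ((edgeSpan 𝓗 J).card - s) := by
        rw [Real.rpow_add hn0, Real.rpow_mul hn0.le, Real.rpow_natCast, Real.rpow_natCast]
    _ ≤ _ := mul_le_mul_of_nonneg_right (pow_le_pow_left₀ hx0.le hx _) (by positivity)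

end Embeddings

section Hypergraphs

variable {β : Type*} [Fintype β] [DecidableEq β] {𝓗 : Finset (Finset β)} {s : ℕ}

lemma PrCopyH_eq (hunif : ∀ A ∈ 𝓗, A.card = s) (n : ℕ) (p η : ℝ) :
    PrCopyH 𝓗 n s p η = ∑ ω : Finset (SEdge n s),
      if ∑ φ, ∏ k, (if edgeEmb hunif n φ k ∈ ω then (1 : ℝ) else 0) ≤
        η * (p ^ 𝓗.card * Fintype.card (β ↪ Fin n)) then pw (fun _ => p) ω else 0 := by
  unfold PrCopyH
  simp only [copyCountH_eq hunif, expCopyH_const hunif]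

lemma PhiCopyH_nonneg {n : ℕ} {p : ℝ} (hp : p ∈ Set.Ioo (0 : ℝ) 1) (η : ℝ) :
    0 ≤ PhiCopyH 𝓗 n s p η := by
  refine Real.sInf_nonneg ?_
  rintro x ⟨q, hq, -, rfl⟩
  exact Finset.sum_nonneg fun e _ => ip_nonneg hp (hq e)

lemma PhiCopyH_le {n : ℕ} {p : ℝ} (hp : p ∈ Set.Ioo (0 : ℝ) 1) {η : ℝ} {q : SEdge n s → ℝ}
    (hq : ∀ e, q e ∈ Set.Icc (0 : ℝ) 1)
    (hfeas : expCopyH 𝓗 n s q ≤ η * expCopyH 𝓗 n s (fun _ => p)) :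
    PhiCopyH 𝓗 n s p η ≤ ∑ e, ip p (q e) := by
  refine csInf_le ⟨0, ?_⟩ ⟨q, hq, hfeas, rfl⟩
  rintro x ⟨q, hq, -, rfl⟩
  exact Finset.sum_nonneg fun e _ => ip_nonneg hp (hq e)

/-- The lower bound on the lower-tail rate, with explicit requirements on `n` and `p`. -/
lemma mul_PhiCopyH_le_neg_log (hs : 1 ≤ s) (hunif : ∀ A ∈ 𝓗, A.card = s) (h𝓗 : 𝓗.Nonempty)
    {n : ℕ} (hn : 2 * Fintype.card β ≤ n) {p : ℝ} (hp : p ∈ Set.Ioo (0 : ℝ) 1) {σ ε η η' : ℝ}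
    (hσ : 0 < σ) (hσ2 : σ ≤ 1 / 2) (hε : 0 < ε) (hε1 : ε < 1) (hη : 0 ≤ η)
    (hη' : η + 2 * ε ≤ η')
    (hσC : 4 * (𝓗.card : ℝ) ^ 3 *
      (2 ^ 𝓗.card * (Fintype.card β : ℝ) ^ Fintype.card β * 2 ^ Fintype.card β) * σ ≤ ε ^ 5)
    (hσp : (n : ℝ) ^ (-(1 / msDensity 𝓗 s)) ≤ σ * p) :
    (1 - ε) * PhiCopyH 𝓗 n s p η' ≤ - Real.log (PrCopyH 𝓗 n s p η) := by
  obtain ⟨A, hA⟩ := id h𝓗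
  have hsb : s ≤ Fintype.card β := hunif A hA ▸ Finset.card_le_univ A
  have hE : 0 < Fintype.card (β ↪ Fin n) := by
    refine Nat.pos_of_mul_pos_left (lt_of_lt_of_le ?_ (pow_le_two_pow_mul_card_embedding hn))
    exact pow_pos (by omega) _
  have hN : 0 < Fintype.card (SEdge n s) := by
    refine Nat.pos_of_mul_pos_left (lt_of_lt_of_le ?_ (pow_le_card_sEdge (by omega)))
    exact pow_pos (by omega) _
  rw [PrCopyH_eq hunif]
  set μ := p ^ 𝓗.card * (Fintype.card (β ↪ Fin n) : ℝ) with hμ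
  have hμ0 : 0 ≤ η * μ :=
    mul_nonneg hη (mul_nonneg (pow_nonneg hp.1.le _) (Nat.cast_nonneg _))
  set T := edgeEmb hunif n with hTdef
  set m : Finset (SEdge n s) → ℝ := fun ω =>
    if ∑ φ, ∏ k, (if T φ k ∈ ω then (1 : ℝ) else 0) ≤ η * μ then pw (fun _ => p) ω else 0 with hm
  have hpw := fun ω : Finset (SEdge n s) => pw_pos (fun _ => hp) ω
  have hm0 : ∀ ω, 0 ≤ m ω := fun ω => by
    simp only [hm]; split_ifs; exacts [(hpw ω).le, le_rfl]
  have hdown : ∀ (v : SEdge n s) ω, v ∉ ω → (1 - p) * m (insert v ω) ≤ p * m ω := by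
    intro v ω hv
    by_cases h : ∑ φ, ∏ k, (if T φ k ∈ insert v ω then (1 : ℝ) else 0) ≤ η * μ
    · have h' : ∑ φ, ∏ k, (if T φ k ∈ ω then (1 : ℝ) else 0) ≤ η * μ := by
        refine le_trans (Finset.sum_le_sum fun φ _ => Finset.prod_le_prod
          (fun k _ => by split_ifs <;> simp) fun k _ => ?_) h
        by_cases hk : T φ k ∈ ω
        · rw [if_pos hk, if_pos (Finset.mem_insert_of_mem hk)]
        · rw [if_neg hk]; split_ifs <;> simp
      simp only [hm, if_pos h, if_pos h']
      exact (pw_insert (q := fun _ => p) hv).le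
    · have h0 : m (insert v ω) = 0 := if_neg h
      rw [h0, mul_zero]
      exact mul_nonneg hp.1.le (hm0 ω)
  have hempty : m ∅ = pw (fun _ => p) (∅ : Finset (SEdge n s)) := by
    refine if_pos (le_of_eq_of_le (Finset.sum_eq_zero fun φ _ => ?_) hμ0)
    refine Finset.prod_eq_zero (Finset.mem_univ ⟨0, h𝓗.card_pos⟩) ?_
    rw [if_neg (Finset.notMem_empty _)]
  have hP : 0 < ∑ ω, m ω := Finset.sum_pos' (fun ω _ => hm0 ω)
    ⟨∅, Finset.mem_univ _, by rw [hempty]; exact hpw ∅⟩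
  have hx0 : 0 ≤ σ * p := mul_nonneg hσ.le hp.1.le
  obtain ⟨q, hq, hfeas, hle⟩ := exists_product_measure_of_lower_tail hm0 hp hdown
    (fun ω h => by
      simp only [hm] at h ⊢
      split_ifs at h ⊢ with h'
      · rfl
      · exact absurd rfl h)
    hP h𝓗.card_pos (edgeEmb_injective hunif n) hE hN hσ hσ2 hε hε1 hσC
    (sum_pow_card_initSeg_union_le hunif hn hx0
      (one_le_pow_mul_pow_edgeSpan hs hunif (by omega) hσp))
    (η := η) (fun ω h => by
      by_contra h'
      exact h (if_neg h'))
  refine le_trans (mul_le_mul_of_nonneg_left (PhiCopyH_le hp hq ?_) (by linarith)) hle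
  rw [expCopyH_eq hunif, expCopyH_const hunif]
  refine hfeas.trans (mul_le_mul_of_nonneg_right hη' ?_)
  exact mul_nonneg (pow_nonneg hp.1.le _) (Nat.cast_nonneg _)

lemma hypergraphs_lower_tail_zero (hs : 1 ≤ s) (h𝓗 : 𝓗.Nonempty)
    (hunif : ∀ A ∈ 𝓗, A.card = s) (p a η : ℝ) :
    PhiCopyH 𝓗 0 s p a = 0 ∧ PrCopyH 𝓗 0 s p η = 1 ∧
      ∀ q : SEdge 0 s → ℝ, ∑ e, ip p (q e) = 0 := by
  obtain ⟨A, hA⟩ := h𝓗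
  have hsE : IsEmpty (SEdge 0 s) := ⟨fun e => by
    have h1 := e.2
    have h2 := Finset.card_le_univ e.1
    rw [Fintype.card_fin] at h2
    omega⟩
  have hb : Nonempty β := by
    obtain ⟨x, -⟩ := Finset.card_pos.1 (by rw [hunif A hA]; omega : 0 < A.card)
    exact ⟨x⟩
  have hφ : IsEmpty (β ↪ Fin 0) := ⟨fun φ => (φ hb.some).elim0⟩
  have hE : ∀ q, expCopyH 𝓗 0 s q = 0 := fun q => by
    rw [expCopyH_eq hunif]; exact Finset.sum_of_isEmpty _
  refine ⟨?_, ?_, fun q => Finset.sum_of_isEmpty _⟩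
  · have : {x | ∃ q : SEdge 0 s → ℝ, (∀ e, q e ∈ Set.Icc (0 : ℝ) 1) ∧
        expCopyH 𝓗 0 s q ≤ a * expCopyH 𝓗 0 s (fun _ => p) ∧ x = ∑ e, ip p (q e)} = {0} := by
      ext x
      simp only [hE, mul_zero, le_refl, true_and, Set.mem_ofPred_eq, Set.mem_singleton_iff]
      constructor
      · rintro ⟨q, -, rfl⟩; exact Finset.sum_of_isEmpty _
      · rintro rfl
        exact ⟨fun _ => 0, fun e => (hsE.false e).elim, (Finset.sum_of_isEmpty _).symm⟩
    unfold PhiCopyH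
    rw [this, csInf_singleton]
  · rw [PrCopyH_eq hunif, ← sum_pw (fun _ : SEdge 0 s => p)]
    refine Finset.sum_congr rfl fun ω _ => if_pos (le_of_eq ?_)
    rw [Finset.sum_of_isEmpty, Fintype.card_eq_zero, Nat.cast_zero, mul_zero, mul_zero]

end Hypergraphs

/-- Theorem `thm:hypergraphs`: for every nonempty `s`-uniform hypergraph `H`, all
`p₀ < 1` and every `ε > 0` there is a constant `L` such that whenever
`L n^{−1/m_s(H)} ≤ p ≤ p₀` and `X = N_H(G^{(s)}(n,p))`, for every `η ∈ [0,1]`,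
`(1−ε) Φ_{n,p}^H(η+ε) ≤ − log Pr(X ≤ η E[X]) ≤ (1+ε) Φ_{n,p}^H((1−ε)η)`.
(The upper bound is rendered by quantifying over all product measures `q` feasible for
the parameter `(1−ε)η`, which is the correct reading of `(1+ε)·min{…}` also when the
feasible set is empty and the minimum is `+∞`.) -/
theorem hypergraphs_lower_tail {β : Type*} [Fintype β] [DecidableEq β] (s : ℕ)
    (hs : 1 ≤ s) (𝓗 : Finset (Finset β)) (h𝓗 : 𝓗.Nonempty)
    (hunif : ∀ A ∈ 𝓗, A.card = s) (p₀ ε : ℝ) (hp₀ : p₀ < 1) (hε : 0 < ε) :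
    ∃ L : ℝ, 0 < L ∧ ∀ (n : ℕ) (p : ℝ),
      L * (n : ℝ) ^ (-(1 / msDensity 𝓗 s)) ≤ p → p ≤ p₀ →
      ∀ η : ℝ, 0 ≤ η → η ≤ 1 →
        (1 - ε) * PhiCopyH 𝓗 n s p (η + ε) ≤ - Real.log (PrCopyH 𝓗 n s p η) ∧
        ∀ q : SEdge n s → ℝ, (∀ e, q e ∈ Set.Icc (0 : ℝ) 1) →
          expCopyH 𝓗 n s q ≤ (1 - ε) * η * expCopyH 𝓗 n s (fun _ => p) →
          - Real.log (PrCopyH 𝓗 n s p η) ≤ (1 + ε) * ∑ e, ip p (q e) := by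
  obtain ⟨A, hA⟩ := id h𝓗
  have hsb : s ≤ Fintype.card β := hunif A hA ▸ Finset.card_le_univ A
  have hs0 : (0 : ℝ) < s := Nat.cast_pos.2 hs
  have hms := one_div_le_msDensity hunif
  have hm0 : 0 < msDensity 𝓗 s := (one_div_pos.2 hs0).trans_le hms
  have hms' : 1 / msDensity 𝓗 s ≤ s := (one_div_le hs0 hm0).1 hms
  set δ := min ε (1 / 2) with hδ
  have hδ0 : 0 < δ := lt_min hε (by norm_num)
  have hδε : δ ≤ ε := min_le_left _ _
  have hδ2 : δ ≤ 1 / 2 := min_le_right _ _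
  set b := Fintype.card β with hb
  have hr0 : (1 : ℝ) ≤ 𝓗.card := Nat.one_le_cast.2 h𝓗.card_pos
  have hb0 : (1 : ℝ) ≤ b := Nat.one_le_cast.2 (hs.trans hsb)
  set C : ℝ := 2 ^ 𝓗.card * (b : ℝ) ^ b * 2 ^ b with hC
  have hC0 : 0 < C := by positivity
  set C' : ℝ := 𝓗.card * (s : ℝ) ^ s * 2 ^ b with hC'
  have hC'1 : 1 ≤ C' := one_le_mul_of_one_le_of_one_le
    (one_le_mul_of_one_le_of_one_le hr0 (one_le_pow₀ (Nat.one_le_cast.2 hs)))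
    (one_le_pow₀ one_le_two)
  set σ := min (1 / 2) ((δ / 2) ^ 5 / (4 * (𝓗.card : ℝ) ^ 3 * C)) with hσ
  have hσ0 : 0 < σ := lt_min (by norm_num) (by positivity)
  have hσC : 4 * (𝓗.card : ℝ) ^ 3 * C * σ ≤ (δ / 2) ^ 5 := by
    rw [mul_comm, ← le_div_iff₀ (by positivity)]
    exact min_le_right _ _
  set D : ℝ := 128 * (8 + 2 * Real.log (1 - p₀) ^ 2) * C' ^ 4 with hD
  have hD0 : 0 < D := by positivity
  set L : ℝ := 1 / σ + (2 * b) ^ s + 2 ^ s * s.factorial * D / δ ^ 7 with hL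
  have hL1 : 1 / σ ≤ L := by
    have : 0 ≤ (2 * (b : ℝ)) ^ s := by positivity
    have : 0 ≤ 2 ^ s * s.factorial * D / δ ^ 7 := by positivity
    linarith
  have hL2 : (2 * (b : ℝ)) ^ s ≤ L := by
    have : 0 ≤ 1 / σ := by positivity
    have : 0 ≤ 2 ^ s * s.factorial * D / δ ^ 7 := by positivity
    linarith
  have hL3 : 2 ^ s * s.factorial * D / δ ^ 7 ≤ L := by
    have : 0 ≤ 1 / σ := by positivity
    have : 0 ≤ (2 * (b : ℝ)) ^ s := by positivity
    linarith
  have hL0 : 0 < L := (by positivity : 0 < 1 / σ).trans_le hL1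
  refine ⟨L, hL0, fun n p hLp hpp₀ η hη hη1 => ?_⟩
  rcases Nat.eq_zero_or_pos n with rfl | hn0
  · obtain ⟨h1, h2, h3⟩ := hypergraphs_lower_tail_zero hs h𝓗 hunif p (η + ε) η
    rw [h1, h2]
    exact ⟨by simp, fun q _ _ => by simp [h3]⟩
  have hn1 : (1 : ℝ) ≤ n := Nat.one_le_cast.2 hn0
  have hnpos : (0 : ℝ) < n := Nat.cast_pos.2 hn0
  have hx0 : 0 < (n : ℝ) ^ (-(1 / msDensity 𝓗 s)) := Real.rpow_pos_of_pos hnpos _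
  have hp0 : 0 < p := (mul_pos hL0 hx0).trans_le hLp
  have hp : p ∈ Set.Ioo (0 : ℝ) 1 := ⟨hp0, hpp₀.trans_lt hp₀⟩
  have hLn : L ≤ p * (n : ℝ) ^ s := by
    have h1 : ((n : ℝ) ^ s)⁻¹ ≤ (n : ℝ) ^ (-(1 / msDensity 𝓗 s)) := by
      rw [← Real.rpow_natCast, ← Real.rpow_neg hnpos.le]
      exact Real.rpow_le_rpow_of_exponent_le hn1 (by linarith)
    have h2 := (mul_le_mul_of_nonneg_left h1 hL0.le).trans hLp
    rwa [← div_eq_mul_inv, div_le_iff₀ (by positivity)] at h2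
  have hn : 2 * b ≤ n := by
    have h1 : (2 * (b : ℝ)) ^ s ≤ (n : ℝ) ^ s :=
      hL2.trans (hLn.trans (mul_le_of_le_one_left (by positivity) hp.2.le))
    have h2 := le_of_pow_le_pow_left₀ (by omega) hnpos.le h1
    exact_mod_cast h2
  constructor
  · have hσp : (n : ℝ) ^ (-(1 / msDensity 𝓗 s)) ≤ σ * p := by
      have := mul_le_mul_of_nonneg_left
        ((mul_le_mul_of_nonneg_right hL1 hx0.le).trans hLp) hσ0.le
      rwa [← mul_assoc, mul_one_div_cancel hσ0.ne', one_mul] at this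
    have h := mul_PhiCopyH_le_neg_log hs hunif h𝓗 hn hp hσ0 (min_le_left _ _) (half_pos hδ0)
      (by linarith) hη (by linarith : η + 2 * (δ / 2) ≤ η + ε) hσC hσp
    refine le_trans (mul_le_mul_of_nonneg_right ?_ (PhiCopyH_nonneg hp _)) h
    linarith
  · intro q hq hfeas
    have hE : 0 < Fintype.card (β ↪ Fin n) := by
      refine Nat.pos_of_mul_pos_left (lt_of_lt_of_le ?_ (pow_le_two_pow_mul_card_embedding hn))
      exact pow_pos hn0 _
    have hns : n ^ s ≤ 2 ^ s * s.factorial * Fintype.card (SEdge n s) :=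
      pow_le_card_sEdge (by omega)
    have hN : 0 < Fintype.card (SEdge n s) :=
      Nat.pos_of_mul_pos_left (lt_of_lt_of_le (pow_pos hn0 _) hns)
    have hns' : (n : ℝ) ^ s ≤ 2 ^ s * s.factorial * (Fintype.card (SEdge n s) : ℝ) := by
      exact_mod_cast hns
    have hbig : D ≤ δ ^ 7 * (p * Fintype.card (SEdge n s)) := by
      have h1 := (hL3.trans hLn).trans (mul_le_mul_of_nonneg_left hns' hp0.le)
      rw [div_le_iff₀ (by positivity)] at h1
      refine le_of_mul_le_mul_left ?_ (by positivity : (0 : ℝ) < 2 ^ s * s.factorial)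
      linarith
    have hμ0 : 0 ≤ p ^ 𝓗.card * (Fintype.card (β ↪ Fin n) : ℝ) :=
      mul_nonneg (pow_nonneg hp0.le _) (Nat.cast_nonneg _)
    have hI0 : 0 ≤ ∑ e, ip p (q e) := Finset.sum_nonneg fun e _ => ip_nonneg hp (hq e)
    rw [expCopyH_eq hunif, expCopyH_const hunif] at hfeas
    rw [PrCopyH_eq hunif]
    refine (neg_log_lower_tail_le (edgeEmb_injective hunif n) h𝓗.card_pos hE hN hp0 hpp₀ hp₀ hδ0
      hδ2 hη hη1 hC'1 (degree_edgeEmb_le hunif h𝓗 hn) hbig hq (hfeas.trans ?_)).trans ?_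
    · refine mul_le_mul_of_nonneg_right (mul_le_mul_of_nonneg_right ?_ hη) hμ0
      linarith
    · exact mul_le_mul_of_nonneg_right (by linarith) hI0

end
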